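/- (Paths of nonzero structure constants) Let λ, μ, ν be partitions. (i) If c^ν_{λμ} ≠ 0 and |ν| > |λ|+|μ|, then there exists a partition ν̃ ⊆ ν with |ν̃| = |ν|−1 and c^{ν̃}_{λμ} ≠ 0. (ii) If c^ν_{λμ} ≠ 0 and |ν| > |λ|+|μ|, then there exists a partition μ̃ ⊇ μ with |μ̃| = |μ|+1 and c^ν_{λμ̃} ≠ 0. (iii) If d^ν_{λμ} ≠ 0 and |ν| < |λ|+|μ|, then there exists a partition ν̃ ⊇ ν with |ν̃| = |ν|+1 and d^{ν̃}_{λμ} ≠ 0. (iv) If d^ν_{λμ} ≠ 0 and |ν| < |λ|+|μ|, then there exists a partition μ̃ ⊆ μ with |μ̃| = |μ|−1 and d^ν_{λμ̃} ≠ 0. For λ ⊆ ν: (v) if α_{ν/λ,μ} ≠ 0 and |μ| > |ν/λ|, then there exists μ̃ ⊆ μ with |μ̃| = |μ|−1 and α_{ν/λ,μ̃} ≠ 0; (vi) if α_{ν/λ,μ} ≠ 0 and |μ| > |ν/λ|, then there exists ν̃ ⊇ ν with |ν̃| = |ν|+1 and α_{ν̃/λ,μ} ≠ 0; (vii) if α_{ν/λ,μ}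 ≠ 0 and |μ| > |ν/λ|, then there exists λ̃ ⊆ λ with |λ̃| = |λ|−1 and α_{ν/λ̃,μ} ≠ 0. -/

import Mathlib

open MvPolynomial

/-- A set-valued tableau on an arbitrary finite set of boxes `(row, column)`.
Entries are `0`-based: the entry `i : ℕ` stands for the integer `i + 1`
(equivalently, for the variable `x_{i+1}`).  Rows weakly increase from left to
right and columns strictly increase from top to bottom, expressed via
horizontally and vertically adjacent boxes. -/
structure SVT (cells : Finset (ℕ × ℕ)) where
  entry : ℕ × ℕ → Finset ℕ
  nonempty_of_mem : ∀ c ∈ cells, (entry c).Nonempty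
  eq_empty_of_not_mem : ∀ c, c ∉ cells → entry c = ∅
  row_weak : ∀ i j, (i, j) ∈ cells → (i, j + 1) ∈ cells →
    ∀ a ∈ entry (i, j), ∀ b ∈ entry (i, j + 1), a ≤ b
  col_strict : ∀ i j, (i, j) ∈ cells → (i + 1, j) ∈ cells →
    ∀ a ∈ entry (i, j), ∀ b ∈ entry (i + 1, j), a < b

namespace SVT

variable {cells : Finset (ℕ × ℕ)}

/-- `|T|`: the total number of integers in the boxes of `T`. -/
def size (T : SVT cells) : ℕ := ∑ c ∈ cells, (T.entry c).card

/-- `T` has all its entries among `{1, …, m}` (i.e. `0`-based entries `< m`). -/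
def Bounded (T : SVT cells) (m : ℕ) : Prop := ∀ c, ∀ x ∈ T.entry c, x < m

/-- The monomial `x^T`, where the exponent of the variable `i` is the number of
boxes of `T` containing `i`. -/
noncomputable def monomial (T : SVT cells) : MvPolynomial ℕ ℤ :=
  ∏ c ∈ cells, ∏ i ∈ T.entry c, X i

/-- The column word of `T`: columns are read from left to right, each column
from bottom to top, the integers within a box in increasing order. -/
def word (T : SVT cells) : List ℕ :=
  (List.range ((cells.sup fun c => max c.1 c.2) + 1)).flatMap fun j =>
    ((List.range ((cells.sup fun c => max c.1 c.2) + 1)).reverse).flatMap fun i =>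
      (T.entry (i, j)).sort (· ≤ ·)

end SVT

/-- The stable Grothendieck polynomial of the shape given by `cells`, in the
variables `x_1, …, x_m` (`0`-based: variables `0, …, m-1`):
`G(cells) = ∑_T (-1)^(|T| - #cells) x^T` over set-valued tableaux `T` of shape
`cells` with entries in `{1, …, m}`. -/
noncomputable def grothendieck (cells : Finset (ℕ × ℕ)) (m : ℕ) : MvPolynomial ℕ ℤ :=
  ∑ᶠ (T : SVT cells) (_ : T.Bounded m), ((-1 : ℤ) ^ (T.size - cells.card)) • T.monomial

/-- A reverse lattice word: every suffix contains, for each `i`, at least as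
many occurrences of `i` as of `i + 1`. -/
def IsRLW (w : List ℕ) : Prop := ∀ s, s <:+ w → ∀ i, s.count (i + 1) ≤ s.count i

/-- A partial reverse lattice word with respect to the (`0`-based, half-open)
interval `[a, b)`:  every suffix contains, for each `t` with `a ≤ t` and
`t + 1 < b`, at least as many occurrences of `t` as of `t + 1`. -/
def IsPartialRLW (a b : ℕ) (w : List ℕ) : Prop :=
  ∀ s, s <:+ w → ∀ t, a ≤ t → t + 1 < b → s.count (t + 1) ≤ s.count t

/-- `w` has content `ν`: the number of occurrences of `i` in `w` is the length
of the `i`-th row of `ν`. -/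
def HasContent (w : List ℕ) (nu : YoungDiagram) : Prop := ∀ i, w.count i = nu.rowLen i

/-- The cells of the skew diagram `λ * μ`, obtained by placing `λ` and `μ`
corner to corner: `λ` occupies rows `0, …, ℓ(λ)-1` shifted right by `μ₁`
columns, and `μ` occupies the rows below row `ℓ(λ)-1`. -/
def starCells (lam mu : YoungDiagram) : Finset (ℕ × ℕ) :=
  (lam.cells.image fun c => (c.1, c.2 + mu.rowLen 0)) ∪
    (mu.cells.image fun c => (c.1 + lam.colLen 0, c.2))

/-- The structure constant `c^ν_{λμ}`: `(-1)^(|ν|-|λ|-|μ|)` times the number of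
set-valued tableaux of shape `λ * μ` whose word is a reverse lattice word with
content `ν`. -/
noncomputable def cLR (lam mu nu : YoungDiagram) : ℤ :=
  (-1 : ℤ) ^ (nu.card - lam.card - mu.card) *
    (Nat.card {T : SVT (starCells lam mu) // IsRLW T.word ∧ HasContent T.word nu} : ℤ)

/-- The coproduct structure constant `d^ν_{λμ}`: `(-1)^(|λ|+|μ|-|ν|)` times the
number of set-valued tableaux of shape `ν` whose word is a partial reverse
lattice word with respect to both intervals `[1, ℓ(λ)]` and
`[ℓ(λ)+1, ℓ(λ)+ℓ(μ)]` and has content `(λ₁, …, λ_{ℓ(λ)}, μ₁, …, μ_{ℓ(μ)})`. -/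
noncomputable def dCoeff (lam mu nu : YoungDiagram) : ℤ :=
  (-1 : ℤ) ^ (lam.card + mu.card - nu.card) *
    (Nat.card {T : SVT nu.cells //
      IsPartialRLW 0 (lam.colLen 0) T.word ∧
      IsPartialRLW (lam.colLen 0) (lam.colLen 0 + mu.colLen 0) T.word ∧
      ∀ i, T.word.count i =
        if i < lam.colLen 0 then lam.rowLen i else mu.rowLen (i - lam.colLen 0)} : ℤ)

/-- The coefficient `α_{θ,μ}` for a shape `θ` given by `cells`:
`(-1)^(|μ|-|θ|)` times the number of set-valued tableaux of shape `θ` whose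
word is a reverse lattice word with content `μ`. -/
noncomputable def alphaCoeff (cells : Finset (ℕ × ℕ)) (mu : YoungDiagram) : ℤ :=
  (-1 : ℤ) ^ (mu.card - cells.card) *
    (Nat.card {T : SVT cells // IsRLW T.word ∧ HasContent T.word mu} : ℤ)

/-- `ν/λ` is a vertical strip: at most one box in each row. -/
def IsVerticalStrip (lam nu : YoungDiagram) : Prop := ∀ i, nu.rowLen i ≤ lam.rowLen i + 1

/-- `ν/λ` is a horizontal strip: at most one box in each column. -/
def IsHorizontalStrip (lam nu : YoungDiagram) : Prop := ∀ j, nu.colLen j ≤ lam.colLen j + 1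

/-- A set of boxes is a rook strip if it has at most one box in each row and in
each column. -/
def IsRookStripCells (s : Finset (ℕ × ℕ)) : Prop :=
  (∀ i, (s.filter fun c => c.1 = i).card ≤ 1) ∧ (∀ j, (s.filter fun c => c.2 = j).card ≤ 1)

/-- The rectangular Young diagram with `p` rows and `q` columns. -/
def rect (p q : ℕ) : YoungDiagram :=
  ⟨Finset.range p ×ˢ Finset.range q, by
    intro a b hba ha
    simp only [Finset.coe_product, Set.mem_prod, Finset.mem_coe, Finset.mem_range] at ha ⊢
    exact ⟨lt_of_le_of_lt hba.1 ha.1, lt_of_le_of_lt hba.2 ha.2⟩⟩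

/-- `f` is the entry function of a set-valued tableau whose set of boxes is `S`. -/
structure IsTab (S : Finset (ℕ × ℕ)) (f : ℕ × ℕ → Finset ℕ) : Prop where
  nonempty : ∀ c ∈ S, (f c).Nonempty
  mem_of_mem : ∀ {c x}, x ∈ f c → c ∈ S
  row : ∀ {i j a b}, a ∈ f (i, j) → b ∈ f (i, j + 1) → a ≤ b
  col : ∀ {i j a b}, a ∈ f (i, j) → b ∈ f (i + 1, j) → a < b

/-- A set of boxes is convex for the componentwise order. -/
def IsConvex (S : Finset (ℕ × ℕ)) : Prop :=
  ∀ a ∈ S, ∀ c ∈ S, ∀ b, a ≤ b → b ≤ c → b ∈ S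

open Classical in
/-- The number of boxes of `S` that satisfy `p` and contain the entry `x`. -/
noncomputable def boxCount (S : Finset (ℕ × ℕ)) (f : ℕ × ℕ → Finset ℕ)
    (p : ℕ × ℕ → Prop) (x : ℕ) : ℕ :=
  (S.filter fun c => p c ∧ x ∈ f c).card

/-- The number of boxes containing `x` in the rows above row `s`. -/
noncomputable def topCount (S : Finset (ℕ × ℕ)) (f : ℕ × ℕ → Finset ℕ) (s x : ℕ) : ℕ :=
  boxCount S f (fun c => c.1 < s) x

/-- The number of boxes containing `x`. -/
noncomputable def totalCount (S : Finset (ℕ × ℕ)) (f : ℕ × ℕ → Finset ℕ) (x : ℕ) : ℕ :=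
  boxCount S f (fun _ => True) x

/-- The lattice condition for the letters `i` and `i + 1` in terms of row contents. -/
def IsLatticeAt (S : Finset (ℕ × ℕ)) (f : ℕ × ℕ → Finset ℕ) (i : ℕ) : Prop :=
  ∀ s, topCount S f (s + 1) (i + 1) ≤ topCount S f s i

/-- Remove the entry `x` from the box `b`. -/
def eraseAt (f : ℕ × ℕ → Finset ℕ) (b : ℕ × ℕ) (x : ℕ) : ℕ × ℕ → Finset ℕ :=
  Function.update f b ((f b).erase x)

/-- Add the entry `x` to the box `b`. -/
def addAt (f : ℕ × ℕ → Finset ℕ) (b : ℕ × ℕ) (x : ℕ) : ℕ × ℕ → Finset ℕ :=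
  Function.update f b (insert x (f b))

theorem mem_eraseAt {f : ℕ × ℕ → Finset ℕ} {b c : ℕ × ℕ} {x y : ℕ} :
    y ∈ eraseAt f b x c ↔ y ∈ f c ∧ ¬(c = b ∧ y = x) := by
  unfold eraseAt
  by_cases h : c = b
  · subst h
    simp [and_comm]
  · simp [h]

theorem mem_addAt {f : ℕ × ℕ → Finset ℕ} {b c : ℕ × ℕ} {x y : ℕ} :
    y ∈ addAt f b x c ↔ y ∈ f c ∨ (c = b ∧ y = x) := by
  unfold addAt
  by_cases h : c = b
  · subst h
    simp [or_comm]
  · simp [h]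

section Counting

variable {S : Finset (ℕ × ℕ)} {f : ℕ × ℕ → Finset ℕ}

open Classical in
theorem boxCount_eraseAt {b : ℕ × ℕ} {y : ℕ} (hb : b ∈ S) (hy : y ∈ f b)
    (p : ℕ × ℕ → Prop) (x : ℕ) :
    boxCount S (eraseAt f b y) p x + (if p b ∧ x = y then 1 else 0) = boxCount S f p x := by
  unfold boxCount
  split_ifs with h
  · obtain ⟨h, rfl⟩ := h
    rw [← Finset.card_erase_add_one (s := S.filter fun c => p c ∧ x ∈ f c) (a := b)
      (by simp [*])]
    congr 2
    ext c
    simp only [Finset.mem_filter, Finset.mem_erase, mem_eraseAt]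
    tauto
  · rw [add_zero]
    congr 1
    ext c
    simp only [Finset.mem_filter, mem_eraseAt]
    constructor
    · tauto
    · rintro ⟨h1, h2, h3⟩
      refine ⟨h1, h2, h3, ?_⟩
      rintro ⟨rfl, rfl⟩
      exact h ⟨h2, rfl⟩

open Classical in
theorem boxCount_addAt {b : ℕ × ℕ} {y : ℕ} (hf : ∀ {c x}, x ∈ f c → c ∈ S) (hy : y ∉ f b)
    (p : ℕ × ℕ → Prop) (x : ℕ) :
    boxCount (insert b S) (addAt f b y) p x
      = boxCount S f p x + (if p b ∧ x = y then 1 else 0) := by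
  unfold boxCount
  split_ifs with h
  · obtain ⟨h, rfl⟩ := h
    rw [← Finset.card_insert_of_notMem (s := S.filter fun c => p c ∧ x ∈ f c) (a := b)
      (by simp [*])]
    congr 1
    ext c
    simp only [Finset.mem_filter, Finset.mem_insert, mem_addAt]
    constructor
    · tauto
    · rintro (rfl | h1)
      · tauto
      · tauto
  · rw [add_zero]
    congr 1
    ext c
    simp only [Finset.mem_filter, Finset.mem_insert, mem_addAt]
    constructor
    · rintro ⟨h1, h2, h3 | ⟨rfl, rfl⟩⟩
      · exact ⟨hf h3, h2, h3⟩
      · exact absurd ⟨h2, rfl⟩ h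
    · tauto

theorem boxCount_mono {p q : ℕ × ℕ → Prop} {x y : ℕ}
    (h : ∀ c ∈ S, p c → x ∈ f c → q c ∧ y ∈ f c) : boxCount S f p x ≤ boxCount S f q y := by
  classical
  unfold boxCount
  apply Finset.card_le_card
  intro c hc
  simp only [Finset.mem_filter] at hc ⊢
  exact ⟨hc.1, h c hc.1 hc.2.1 hc.2.2⟩

theorem boxCount_eq_zero {p : ℕ × ℕ → Prop} {x : ℕ} (h : ∀ c ∈ S, p c → x ∉ f c) :
    boxCount S f p x = 0 := by
  classical
  unfold boxCount
  rw [Finset.card_eq_zero, Finset.filter_eq_empty_iff]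
  rintro c hc ⟨h1, h2⟩
  exact h c hc h1 h2

theorem exists_of_boxCount_pos {p : ℕ × ℕ → Prop} {x : ℕ} (h : 0 < boxCount S f p x) :
    ∃ c ∈ S, p c ∧ x ∈ f c := by
  by_contra! hc
  exact h.ne' (boxCount_eq_zero hc)

theorem boxCount_pos {p : ℕ × ℕ → Prop} {x : ℕ} {c : ℕ × ℕ} (hc : c ∈ S) (hp : p c)
    (hx : x ∈ f c) : 0 < boxCount S f p x := by
  classical
  unfold boxCount
  exact Finset.card_pos.2 ⟨c, by simp [*]⟩

theorem boxCount_add_of_split {p q r : ℕ × ℕ → Prop} {x : ℕ}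
    (h : ∀ c ∈ S, x ∈ f c → (p c ↔ q c ∨ r c)) (hd : ∀ c ∈ S, x ∈ f c → q c → ¬ r c) :
    boxCount S f p x = boxCount S f q x + boxCount S f r x := by
  classical
  unfold boxCount
  rw [← Finset.card_union_of_disjoint]
  · congr 1
    ext c
    simp only [Finset.mem_filter, Finset.mem_union]
    have := h c
    tauto
  · rw [Finset.disjoint_left]
    intro c
    simp only [Finset.mem_filter]
    have := hd c
    tauto

theorem topCount_succ (s x : ℕ) :
    topCount S f (s + 1) x = topCount S f s x + boxCount S f (fun c => c.1 = s) x :=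
  boxCount_add_of_split (fun c _ _ => by omega) (fun c _ _ => by omega)

theorem topCount_zero (x : ℕ) : topCount S f 0 x = 0 :=
  boxCount_eq_zero (by simp)

theorem boxCount_le_of_shift {p q : ℕ × ℕ → Prop} {x y : ℕ} (g : ℕ × ℕ → ℕ × ℕ)
    (hg : ∀ c ∈ S, p c → x ∈ f c → g c ∈ S ∧ q (g c) ∧ y ∈ f (g c))
    (hinj : ∀ c ∈ S, p c → x ∈ f c → ∀ d ∈ S, p d → x ∈ f d → g c = g d → c = d) :
    boxCount S f p x ≤ boxCount S f q y := by
  classical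
  unfold boxCount
  apply Finset.card_le_card_of_injOn g
  · intro c hc
    simp only [Finset.coe_filter, Set.mem_ofPred_eq] at hc ⊢
    exact hg c hc.1 hc.2.1 hc.2.2
  · intro c hc d hd h
    simp only [Finset.coe_filter, Set.mem_ofPred_eq] at hc hd
    exact hinj c hc.1 hc.2.1 hc.2.2 d hd.1 hd.2.1 hd.2.2 h

theorem sum_totalCount {M : ℕ} (hM : ∀ c ∈ S, ∀ x ∈ f c, x < M) :
    ∑ x ∈ Finset.range M, totalCount S f x = ∑ c ∈ S, (f c).card := by
  classical
  have h1 : ∀ x, totalCount S f x = ∑ c ∈ S, if x ∈ f c then 1 else 0 := by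
    intro x
    rw [totalCount, boxCount, Finset.card_filter]
    simp only [true_and]
  simp only [h1]
  rw [Finset.sum_comm]
  refine Finset.sum_congr rfl fun c hc => ?_
  rw [← Finset.card_filter]
  congr 1
  ext x
  simp only [Finset.mem_filter, Finset.mem_range]
  exact ⟨fun h => h.2, fun h => ⟨hM c hc x h, h⟩⟩

end Counting

namespace IsTab

variable {S : Finset (ℕ × ℕ)} {f : ℕ × ℕ → Finset ℕ}

theorem eraseAt (hf : IsTab S f) {b : ℕ × ℕ} {y z : ℕ} (hz : z ∈ f b) (hzy : z ≠ y) :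
    IsTab S (eraseAt f b y) where
  nonempty c hc := by
    by_cases h : c = b
    · subst h
      exact ⟨z, mem_eraseAt.2 ⟨hz, by tauto⟩⟩
    · obtain ⟨x, hx⟩ := hf.nonempty c hc
      exact ⟨x, mem_eraseAt.2 ⟨hx, by tauto⟩⟩
  mem_of_mem h := hf.mem_of_mem (mem_eraseAt.1 h).1
  row ha hb := hf.row (mem_eraseAt.1 ha).1 (mem_eraseAt.1 hb).1
  col ha hb := hf.col (mem_eraseAt.1 ha).1 (mem_eraseAt.1 hb).1

theorem addAt (hf : IsTab S f) {r k y : ℕ} (left : ∀ j, j + 1 = k → ∀ a ∈ f (r, j), a ≤ y)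
    (right : ∀ a ∈ f (r, k + 1), y ≤ a) (above : ∀ i, i + 1 = r → ∀ a ∈ f (i, k), a < y)
    (below : ∀ a ∈ f (r + 1, k), y < a) :
    IsTab (insert (r, k) S) (addAt f (r, k) y) where
  nonempty c hc := by
    rcases Finset.mem_insert.1 hc with rfl | hc
    · exact ⟨y, mem_addAt.2 (by tauto)⟩
    · obtain ⟨x, hx⟩ := hf.nonempty c hc
      exact ⟨x, mem_addAt.2 (by tauto)⟩
  mem_of_mem h := by
    rcases mem_addAt.1 h with h | ⟨rfl, -⟩
    · exact Finset.mem_insert_of_mem (hf.mem_of_mem h)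
    · exact Finset.mem_insert_self _ _
  row {i j a b} ha hb := by
    rcases mem_addAt.1 ha with ha' | ⟨h, rfl⟩ <;>
      rcases mem_addAt.1 hb with hb' | ⟨h', rfl⟩
    · exact hf.row ha' hb'
    · simp only [Prod.mk.injEq] at h'
      obtain ⟨rfl, h'⟩ := h'
      exact left j h' a ha'
    · simp only [Prod.mk.injEq] at h
      obtain ⟨rfl, rfl⟩ := h
      exact right b hb'
    · exact le_rfl
  col {i j a b} ha hb := by
    rcases mem_addAt.1 ha with ha' | ⟨h, rfl⟩ <;>
      rcases mem_addAt.1 hb with hb' | ⟨h', rfl⟩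
    · exact hf.col ha' hb'
    · simp only [Prod.mk.injEq] at h'
      obtain ⟨h', rfl⟩ := h'
      exact above i h' a ha'
    · simp only [Prod.mk.injEq] at h
      obtain ⟨rfl, rfl⟩ := h
      exact below b hb'
    · simp only [Prod.mk.injEq] at h h'
      omega

theorem row_le (hf : IsTab S f) (hS : IsConvex S) {i j k a b : ℕ} (hjk : j < k)
    (ha : a ∈ f (i, j)) (hb : b ∈ f (i, k)) : a ≤ b := by
  obtain ⟨n, rfl⟩ := Nat.exists_eq_add_of_lt hjk
  induction n generalizing b with
  | zero => exact hf.row ha hb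
  | succ n ih =>
    obtain ⟨x, hx⟩ := hf.nonempty (i, j + n + 1) (hS _ (hf.mem_of_mem ha) _ (hf.mem_of_mem hb) _
      ⟨le_rfl, by dsimp; omega⟩ ⟨le_rfl, by dsimp; omega⟩)
    exact (ih (by omega) hx).trans (hf.row hx hb)

theorem col_lt (hf : IsTab S f) (hS : IsConvex S) {i k j a b : ℕ} (hik : i < k)
    (ha : a ∈ f (i, j)) (hb : b ∈ f (k, j)) : a < b := by
  obtain ⟨n, rfl⟩ := Nat.exists_eq_add_of_lt hik
  induction n generalizing b with
  | zero => exact hf.col ha hb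
  | succ n ih =>
    obtain ⟨x, hx⟩ := hf.nonempty (i + n + 1, j) (hS _ (hf.mem_of_mem ha) _ (hf.mem_of_mem hb) _
      ⟨by dsimp; omega, le_rfl⟩ ⟨by dsimp; omega, le_rfl⟩)
    exact (ih (by omega) hx).trans (hf.col hx hb)

theorem lt_of_lt_of_le (hf : IsTab S f) (hS : IsConvex S) {i j k m a b : ℕ} (hik : i < k)
    (hjm : j ≤ m) (ha : a ∈ f (i, j)) (hb : b ∈ f (k, m)) : a < b := by
  rcases hjm.eq_or_lt with rfl | hjm
  · exact hf.col_lt hS hik ha hb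
  · obtain ⟨x, hx⟩ := hf.nonempty (i, m) (hS _ (hf.mem_of_mem ha) _ (hf.mem_of_mem hb) _
      ⟨le_rfl, hjm.le⟩ ⟨hik.le, le_rfl⟩)
    exact (hf.row_le hS hjm ha hx).trans_lt (hf.col_lt hS hik hx hb)

end IsTab

section Removal

variable {S : Finset (ℕ × ℕ)}

/-- Removing one letter: in the tableau `f` one occurrence of `a` in row `r` has already been
taken out, which affects the lattice condition; repair it by lowering larger letters. -/
theorem exists_isLatticeAt_of_missing (hS : IsConvex S) (P : Set ℕ) (M n : ℕ) :
    ∀ (a r : ℕ) (f : ℕ × ℕ → Finset ℕ), M ≤ a + n → IsTab S f →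
    (∀ c, ∀ x ∈ f c, x < M) → (∀ c, ∀ x ∈ f c, a < x → f c = {x}) →
    (∀ i ∈ P, ∀ s, topCount S f (s + 1) (i + 1) + (if r + 2 ≤ s + 1 ∧ i + 1 = a then 1 else 0) ≤
      topCount S f s i + if r + 1 ≤ s ∧ i = a then 1 else 0) →
    ∃ b, a ≤ b ∧ ∃ f', IsTab S f' ∧ (∀ i ∈ P, IsLatticeAt S f' i) ∧
      ∀ i, totalCount S f' i + (if i = b then 1 else 0)
        = totalCount S f i + if i = a then 1 else 0 := by
  classical
  induction n with
  | zero =>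
    intro a r f hM hf hfM _ hinv
    refine ⟨a, le_rfl, f, hf, fun i hi s => ?_, fun i => rfl⟩
    have h := hinv i hi s
    by_cases hia : i = a
    · have h0 : topCount S f (s + 1) (i + 1) = 0 :=
        boxCount_eq_zero fun c _ _ hx => by have := hfM c _ hx; omega
      omega
    · simp only [hia, and_false, if_false] at h
      omega
  | succ n ih =>
    intro a r f hM hf hfM hsing hinv
    by_cases hv : a ∈ P ∧ ∃ s, topCount S f s a < topCount S f (s + 1) (a + 1)
    swap
    · refine ⟨a, le_rfl, f, hf, fun i hi s => ?_, fun i => rfl⟩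
      by_cases hia : i = a
      · subst hia
        by_contra! hlt
        exact hv ⟨hi, s, hlt⟩
      · have h := hinv i hi s
        simp only [hia, and_false, if_false] at h
        omega
    obtain ⟨haP, hv⟩ := hv
    obtain ⟨s, hs, hmin⟩ : ∃ s, topCount S f s a < topCount S f (s + 1) (a + 1) ∧
        ∀ t < s, topCount S f (t + 1) (a + 1) ≤ topCount S f t a :=
      ⟨Nat.find hv, Nat.find_spec hv, fun t ht => not_lt.1 (Nat.find_min hv ht)⟩
    have hsr : r + 1 ≤ s ∧ topCount S f (s + 1) (a + 1) = topCount S f s a + 1 := by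
      have h := hinv a haP s
      simp only [and_true] at h
      split_ifs at h with h1 <;> omega
    obtain ⟨hrs, heq⟩ := hsr
    obtain ⟨s, rfl⟩ : ∃ s', s = s' + 1 := ⟨s - 1, by omega⟩
    have hs1 := hmin s (by omega)
    have hta := topCount_succ (S := S) (f := f) s a
    have hta1 := topCount_succ (S := S) (f := f) (s + 1) (a + 1)
    have hex : ∃ k, a + 1 ∈ f (s + 1, k) := by
      obtain ⟨⟨i, k⟩, -, hi, hx⟩ := exists_of_boxCount_pos (S := S) (f := f)
        (p := fun c => c.1 = s + 1) (x := a + 1) (by omega)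
      obtain rfl : i = s + 1 := hi
      exact ⟨k, hx⟩
    obtain ⟨k, hk, hkmin⟩ : ∃ k, a + 1 ∈ f (s + 1, k) ∧ ∀ j < k, a + 1 ∉ f (s + 1, j) :=
      ⟨Nat.find hex, Nat.find_spec hex, fun t ht => Nat.find_min hex ht⟩
    have hbox := hsing _ _ hk (by omega)
    have habove : a ∉ f (s, k) := by
      intro ha
      have hle : boxCount S f (fun c => c.1 = s + 1) (a + 1) ≤
          boxCount S f (fun c => c.1 = s) a := by
        refine boxCount_le_of_shift (fun c => (s, c.2)) ?_ ?_
        · rintro ⟨i, m⟩ hc hi hx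
          obtain rfl : i = s + 1 := hi
          have hkm : k ≤ m := by
            by_contra! hlt
            exact hkmin m hlt hx
          have hmem : (s, m) ∈ S := hS _ (hf.mem_of_mem ha) _ hc _ ⟨le_rfl, hkm⟩
            ⟨by dsimp; omega, le_rfl⟩
          refine ⟨hmem, rfl, ?_⟩
          rcases hkm.eq_or_lt with rfl | hkm
          · exact ha
          · obtain ⟨y, hy⟩ := hf.nonempty _ hmem
            have h1 := hf.row_le hS hkm ha hy
            have h2 := hf.col hy hx
            obtain rfl : y = a := by omega
            exact hy
        · rintro ⟨i, m⟩ _ hi _ ⟨i', m'⟩ _ hi' _ h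
          simp_all
      omega
    have hmem : (s + 1, k) ∈ S := hf.mem_of_mem hk
    have hna : a ∉ f (s + 1, k) := by simp [hbox]
    have hf1 : IsTab S (addAt f (s + 1, k) a) := by
      have := hf.addAt (r := s + 1) (k := k) (y := a) ?_ ?_ ?_ ?_
      · rwa [Finset.insert_eq_of_mem hmem] at this
      · rintro j rfl x hx
        have h1 := hf.row hx hk
        have h2 : x ≠ a + 1 := by
          rintro rfl
          exact hkmin j (by omega) hx
        omega
      · intro x hx
        have := hf.row hk hx
        omega
      · intro i hi x hx
        obtain rfl : i = s := by omega
        have h1 := hf.col hx hk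
        have h2 : x ≠ a := by
          rintro rfl
          exact habove hx
        omega
      · intro x hx
        have := hf.col hk hx
        omega
    have hf2 : IsTab S (eraseAt (addAt f (s + 1, k) a) (s + 1, k) (a + 1)) :=
      hf1.eraseAt (z := a) (mem_addAt.2 (by tauto)) (by omega)
    have hcount : ∀ p x, boxCount S (eraseAt (addAt f (s + 1, k) a) (s + 1, k) (a + 1)) p x
        + (if p (s + 1, k) ∧ x = a + 1 then 1 else 0)
        = boxCount S f p x + if p (s + 1, k) ∧ x = a then 1 else 0 := by
      intro p x
      rw [boxCount_eraseAt hmem (mem_addAt.2 (Or.inl hk))]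
      have := boxCount_addAt (fun h => hf.mem_of_mem h) hna p x
      rwa [Finset.insert_eq_of_mem hmem] at this
    have key := ih (a + 1) (s + 1) _ (by omega) hf2 ?_ ?_ ?_
    · obtain ⟨b, hb, f', hf', hP, htot⟩ := key
      refine ⟨b, by omega, f', hf', hP, fun i => ?_⟩
      have h1 := htot i
      have h2 := hcount (fun _ => True) i
      simp only [true_and] at h2
      simp only [totalCount] at h1 ⊢
      omega
    · intro c x hx
      rw [mem_eraseAt, mem_addAt] at hx
      rcases hx.1 with h | ⟨-, rfl⟩
      · exact hfM _ _ h
      · have := hfM _ _ hk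
        omega
    · intro c x hx hax
      rw [mem_eraseAt, mem_addAt] at hx
      obtain ⟨h | ⟨-, rfl⟩, h'⟩ := hx
      · have hc := hsing c x h (by omega)
        have hne : c ≠ (s + 1, k) := by
          rintro rfl
          rw [hbox] at h
          simp only [Finset.mem_singleton] at h
          omega
        simp [eraseAt, addAt, hne, hc]
      · omega
    · intro i hi t
      have h1 := hcount (fun c => c.1 < t + 1) (i + 1)
      have h2 := hcount (fun c => c.1 < t) i
      have h3 := hinv i hi t
      simp only [topCount] at h3 hmin heq ⊢
      dsimp only at h1 h2
      by_cases hia : i = a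
      · subst hia
        have h4 := hmin t
        rcases lt_trichotomy t (s + 1) with ht | rfl | ht
        · have := h4 ht
          split_ifs at h1 h2 ⊢ <;> omega
        · split_ifs at h1 h2 ⊢ <;> omega
        · split_ifs at h1 h2 h3 ⊢ <;> omega
      · simp only [hia, and_false, if_false, add_zero, add_left_inj] at h1 h2 h3 ⊢
        by_cases hi1 : i + 1 = a
        · have hne : i ≠ a + 1 := by omega
          simp only [hi1, hne, and_true, and_false, if_false, add_zero] at h1 h2 h3 ⊢
          split_ifs at h1 h3 ⊢ <;> omega
        · simp only [hi1, and_false, if_false, add_zero] at h1 h2 h3 ⊢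
          split_ifs at h2 ⊢ <;> omega

/-- If some box with several entries contains an entry `x`, then a letter `b ≥ x` can be removed
from the content while keeping the shape. -/
theorem exists_remove (hS : IsConvex S) {f : ℕ × ℕ → Finset ℕ} (hf : IsTab S f) {P : Set ℕ}
    (hP : ∀ i ∈ P, IsLatticeAt S f i) {c : ℕ × ℕ} {x : ℕ} (hx : x ∈ f c)
    (hc : 1 < (f c).card) :
    ∃ b, x ≤ b ∧ ∃ f', IsTab S f' ∧ (∀ i ∈ P, IsLatticeAt S f' i) ∧
      ∀ i, totalCount S f' i + (if i = b then 1 else 0) = totalCount S f i := by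
  classical
  have hfin : ∃ M, ∀ c, ∀ x ∈ f c, x < M := by
    refine ⟨(S.sup fun c => (f c).sup id) + 1, fun c x hx => Nat.lt_succ_of_le ?_⟩
    exact (Finset.le_sup (f := id) hx).trans
      (Finset.le_sup (f := fun c => (f c).sup id) (hf.mem_of_mem hx))
  obtain ⟨M, hM⟩ := hfin
  obtain ⟨a, ⟨⟨⟨r, k⟩, hac, hcard⟩, hxa⟩, hmax⟩ : ∃ a, ((∃ c, a ∈ f c ∧ 1 < (f c).card) ∧ x ≤ a) ∧
      ∀ y, (∃ c, y ∈ f c ∧ 1 < (f c).card) → y ≤ a := by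
    have hb : ∀ y, (∃ c, y ∈ f c ∧ 1 < (f c).card) → y ≤ M :=
      fun y ⟨c, hy, _⟩ => (hM c y hy).le
    have h0 : ∃ c, x ∈ f c ∧ 1 < (f c).card := ⟨c, hx, hc⟩
    exact ⟨Nat.findGreatest (fun y => ∃ c, y ∈ f c ∧ 1 < (f c).card) M,
      ⟨Nat.findGreatest_spec (P := fun y => ∃ c, y ∈ f c ∧ 1 < (f c).card) (hb x h0) h0,
        Nat.le_findGreatest (hb x h0) h0⟩,
      fun y hy => Nat.le_findGreatest (hb y hy) hy⟩
  obtain ⟨z, hz, hza⟩ := Finset.exists_mem_ne hcard a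
  have hcount := boxCount_eraseAt (hf.mem_of_mem hac) hac
  have key := exists_isLatticeAt_of_missing hS P M M a r
    (eraseAt f (r, k) a) (by omega) (hf.eraseAt hz hza)
    (fun c x hx => hM c x (mem_eraseAt.1 hx).1) ?_ ?_
  · obtain ⟨b, hb, f', hf', hP', htot⟩ := key
    refine ⟨b, hxa.trans hb, f', hf', hP', fun i => ?_⟩
    have h1 := hcount (fun _ => True) i
    simp only [true_and] at h1
    rw [htot i, totalCount, h1, totalCount]
  · intro c x hx hax
    rw [mem_eraseAt] at hx
    have hne : c ≠ (r, k) := by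
      rintro rfl
      exact absurd (hmax x ⟨_, hx.1, hcard⟩) (by omega)
    have hle : (f c).card ≤ 1 := by
      by_contra! hlt
      exact absurd (hmax x ⟨_, hx.1, hlt⟩) (by omega)
    rw [eraseAt, Function.update_of_ne hne]
    exact Finset.eq_singleton_iff_unique_mem.2
      ⟨hx.1, fun y hy => Finset.card_le_one.1 hle _ hy _ hx.1⟩
  · intro i hi s
    have h1 := hcount (fun c => c.1 < s + 1) (i + 1)
    have h2 := hcount (fun c => c.1 < s) i
    have h3 := hP i hi s
    simp only [topCount] at h3 ⊢
    dsimp only at h1 h2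
    split_ifs at h1 h2 ⊢ <;> omega

end Removal

section Moves

variable {S : Finset (ℕ × ℕ)} {l e : ℕ → ℕ}

theorem isConvex_of_rows (hS : ∀ i j, (i, j) ∈ S ↔ l i ≤ j ∧ j < e i) (hl : Antitone l)
    (he : Antitone e) : IsConvex S := by
  rintro ⟨i, j⟩ h1 ⟨i', j'⟩ h2 ⟨i'', j''⟩ ⟨h3, h4⟩ ⟨h5, h6⟩
  rw [hS] at h1 h2 ⊢
  dsimp only at h3 h4 h5 h6
  have := hl h3
  have := he h5
  omega

open Classical in
theorem boxCount_move {f : ℕ × ℕ → Finset ℕ} (hf : IsTab S f) {b c : ℕ × ℕ} {y : ℕ}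
    (hb : y ∈ f b) (hc : y ∉ f c) (p : ℕ × ℕ → Prop) (x : ℕ) :
    boxCount (insert c S) (addAt (eraseAt f b y) c y) p x + (if p b ∧ x = y then 1 else 0) =
      boxCount S f p x + if p c ∧ x = y then 1 else 0 := by
  have h1 := boxCount_addAt (S := S) (f := eraseAt f b y)
    (fun h => hf.mem_of_mem (mem_eraseAt.1 h).1) (fun h => hc (mem_eraseAt.1 h).1) p x
  have h2 := boxCount_eraseAt (hf.mem_of_mem hb) hb p x
  rw [h1, ← h2]
  ring

/-- The bumping process that moves an entry of a box with several entries to lower rows, until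
it creates a new box at the end of a row. -/
theorem exists_push_down (hS : ∀ i j, (i, j) ∈ S ↔ l i ≤ j ∧ j < e i) (hl : Antitone l)
    (he : Antitone e) (P : Set ℕ) (n : ℕ) :
    ∀ (r j y : ℕ) (f : ℕ × ℕ → Finset ℕ), (∀ c ∈ S, c.1 < r + n) → IsTab S f → y ∈ f (r, j) →
    (∀ x ∈ f (r, j), x ≤ y) → (∃ x ∈ f (r, j), x ≠ y) →
    (∀ c x z, r < c.1 → x ∈ f c → z ∈ f c → x = z) →
    (∀ i ∈ P, ∀ s, topCount S f (s + 1) (i + 1) ≤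
      topCount S f s i + if s = r ∧ i + 1 = y then 1 else 0) →
    ∃ t, r ≤ t ∧ e (t + 1) < e t ∧ ∃ f', IsTab (insert (t + 1, e (t + 1)) S) f' ∧
      (∀ i ∈ P, IsLatticeAt (insert (t + 1, e (t + 1)) S) f' i) ∧
      ∀ i, totalCount (insert (t + 1, e (t + 1)) S) f' i = totalCount S f i := by
  classical
  have hconv := isConvex_of_rows hS hl he
  induction n with
  | zero =>
    intro r j y f hbd hf hy
    have := hbd _ (hf.mem_of_mem hy)
    simp at this
  | succ n ih =>
    intro r j y f hbd hf hy hmax hw hsing hinv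
    obtain ⟨w, hw, hwy⟩ := hw
    have hwlt : w < y := lt_of_le_of_ne (hmax w hw) hwy
    have hrj := (hS _ _).1 (hf.mem_of_mem hy)
    have hnext : (r + 1, j) ∈ S ∨ e (r + 1) ≤ j := by
      rw [hS]
      have := hl (Nat.le_add_right r 1)
      omega
    have hno : (∀ m, y + 1 ∉ f (r + 1, m)) → y ∈ P →
        topCount S f (r + 1 + 1) (y + 1) + 1 ≤ topCount S f (r + 1) y := by
      intro h hyP
      have h0 : boxCount S f (fun c => c.1 = r + 1) (y + 1) = 0 := by
        refine boxCount_eq_zero ?_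
        rintro ⟨i, m⟩ - hi
        obtain rfl : i = r + 1 := hi
        exact h m
      have h1 := topCount_succ (S := S) (f := f) (r + 1) (y + 1)
      have h2 := topCount_succ (S := S) (f := f) r y
      have h3 : 0 < boxCount S f (fun c => c.1 = r) y := boxCount_pos (hf.mem_of_mem hy) rfl hy
      have h4 := hinv y hyP r
      rw [if_neg (by omega)] at h4
      omega
    have habove : ∀ m ≤ j, ∀ i, i + 1 = r + 1 → ∀ a ∈ eraseAt f (r, j) y (i, m), a < y := by
      intro m hm i hi a ha
      obtain rfl : i = r := by omega
      rw [mem_eraseAt] at ha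
      rcases hm.eq_or_lt with rfl | hm
      · exact lt_of_le_of_ne (hmax a ha.1) fun h => ha.2 ⟨rfl, h⟩
      · exact (hf.row_le hconv hm ha.1 hw).trans_lt hwlt
    have hf1 := hf.eraseAt hw hwy
    have hsub : ∀ {c x}, x ∈ eraseAt f (r, j) y c → x ∈ f c := fun h => (mem_eraseAt.1 h).1
    by_cases hex : ∃ m, ∃ z ∈ f (r + 1, m), y < z
    · obtain ⟨m, ⟨z, hz, hyz⟩, hmin⟩ : ∃ m, (∃ z ∈ f (r + 1, m), y < z) ∧
          ∀ k < m, ¬ ∃ z ∈ f (r + 1, k), y < z :=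
        ⟨Nat.find hex, Nat.find_spec hex, fun t ht => Nat.find_min hex ht⟩
      push Not at hmin
      have hzS := hf.mem_of_mem hz
      have hmj : m ≤ j := by
        rcases hnext with h | h
        · obtain ⟨x, hx⟩ := hf.nonempty _ h
          have h1 := hf.col hy hx
          by_contra! h2
          have := hmin j h2 x hx
          omega
        · have := (hS _ _).1 hzS
          omega
      have hynot : y ∉ f (r + 1, m) := fun h => hyz.ne (hsing _ _ _ (by simp) h hz)
      have hf2 := hf1.addAt (r := r + 1) (k := m) (y := y)
        (fun k hk a ha => hmin k (by omega) a (hsub ha))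
        (fun a ha => hyz.le.trans (hf.row hz (hsub ha))) (habove m hmj)
        (fun a ha => hyz.trans (hf.col hz (hsub ha)))
      have hcount := boxCount_move hf hy hynot
      rw [Finset.insert_eq_of_mem hzS] at hf2 hcount
      have key := ih (r + 1) m z _ (fun c hc => by have := hbd c hc; omega) hf2
        (mem_addAt.2 (Or.inl (mem_eraseAt.2 ⟨hz, by simp⟩))) ?_
        ⟨y, mem_addAt.2 (by tauto), hyz.ne⟩ ?_ ?_
      · obtain ⟨t, ht, het, f', hf', hP, htot⟩ := key
        refine ⟨t, by omega, het, f', hf', hP, fun i => ?_⟩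
        have := hcount (fun _ => True) i
        rw [htot i, totalCount, totalCount]
        omega
      · intro x hx
        rw [mem_addAt] at hx
        rcases hx with hx | ⟨-, rfl⟩
        · exact (hsing _ _ _ (by simp) (hsub hx) hz).le
        · exact hyz.le
      · intro c x x' hc hx hx'
        rw [mem_addAt] at hx hx'
        rcases hx with hx | ⟨rfl, -⟩
        · rcases hx' with hx' | ⟨rfl, -⟩
          · exact hsing c x x' (by omega) (hsub hx) (hsub hx')
          · simp at hc
        · simp at hc
      · intro i hi s
        have h1 := hcount (fun c => c.1 < s + 1) (i + 1)
        have h2 := hcount (fun c => c.1 < s) i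
        have h3 := hinv i hi s
        dsimp only at h1 h2
        simp only [topCount] at h3 hno ⊢
        by_cases hiy : i = y
        · subst hiy
          simp only [and_true, Nat.succ_ne_self, and_false, if_false, add_zero] at h1 h2 h3 ⊢
          rcases lt_trichotomy s (r + 1) with hs | rfl | hs
          · rw [if_neg (by omega), if_neg (by omega)] at h2
            rw [if_neg (by omega)]
            omega
          · rw [if_pos (by omega), if_neg (by omega)] at h2
            by_cases hz1 : i + 1 = z
            · rw [if_pos ⟨rfl, hz1⟩]
              omega
            · rw [if_neg (by omega)]
              have := hno (fun k hk => ?_) hi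
              · omega
              · rcases lt_trichotomy k m with hkm | rfl | hkm
                · have := hmin k hkm _ hk
                  omega
                · exact hz1 (hsing _ _ _ (by simp) hk hz)
                · have := hf.row_le hconv hkm hz hk
                  omega
          · rw [if_pos (by omega), if_pos (by omega)] at h2
            rw [if_neg (by omega)]
            omega
        · simp only [hiy, and_false, if_false, add_zero] at h2
          split_ifs at h1 h3 <;> omega
    · push Not at hex
      have hej : e (r + 1) ≤ j := by
        rcases hnext with h | h
        · obtain ⟨x, hx⟩ := hf.nonempty _ h
          have h1 := hf.col hy hx
          have h2 := hex j x hx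
          omega
        · exact h
      have hynot : y ∉ f (r + 1, e (r + 1)) := fun h => by
        have := (hS _ _).1 (hf.mem_of_mem h)
        omega
      have hf2 := hf1.addAt (r := r + 1) (k := e (r + 1)) (y := y)
        (fun k _ a ha => hex k a (hsub ha))
        (fun a ha => by
          have := (hS _ _).1 (hf1.mem_of_mem ha)
          omega)
        (habove _ hej)
        (fun a ha => by
          have h1 := (hS _ _).1 (hf1.mem_of_mem ha)
          have h2 := he (Nat.le_succ (r + 1))
          simp only [Nat.succ_eq_add_one] at h2
          omega)
      have hcount := boxCount_move hf hy hynot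
      refine ⟨r, le_rfl, by omega, _, hf2, fun i hi s => ?_, fun i => ?_⟩
      · have h1 := hcount (fun c => c.1 < s + 1) (i + 1)
        have h2 := hcount (fun c => c.1 < s) i
        have h3 := hinv i hi s
        dsimp only at h1 h2
        simp only [topCount] at h3 hno ⊢
        by_cases hiy : i = y
        · subst hiy
          simp only [and_true, Nat.succ_ne_self, and_false, if_false, add_zero] at h1 h2 h3 ⊢
          have h4 := hno (fun k hk => by have := hex k _ hk; omega) hi
          rcases lt_trichotomy s (r + 1) with hs | rfl | hs
          · rw [if_neg (by omega), if_neg (by omega)] at h2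
            omega
          · rw [if_pos (by omega), if_neg (by omega)] at h2
            omega
          · rw [if_pos (by omega), if_pos (by omega)] at h2
            omega
        · simp only [hiy, and_false, if_false, add_zero] at h2
          split_ifs at h1 h3 <;> omega
      · have := hcount (fun _ => True) i
        rw [totalCount, totalCount]
        omega

/-- If some box has several entries, a box can be added at the end of a lower row while keeping
the content. -/
theorem exists_add_box_below (hS : ∀ i j, (i, j) ∈ S ↔ l i ≤ j ∧ j < e i) (hl : Antitone l)
    (he : Antitone e) {f : ℕ × ℕ → Finset ℕ} (hf : IsTab S f) {P : Set ℕ}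
    (hP : ∀ i ∈ P, IsLatticeAt S f i) (hc : ∃ c, 1 < (f c).card) :
    ∃ c, 1 < (f c).card ∧ ∃ t, c.1 ≤ t ∧ e (t + 1) < e t ∧
      ∃ f', IsTab (insert (t + 1, e (t + 1)) S) f' ∧
      (∀ i ∈ P, IsLatticeAt (insert (t + 1, e (t + 1)) S) f' i) ∧
      ∀ i, totalCount (insert (t + 1, e (t + 1)) S) f' i = totalCount S f i := by
  classical
  have hR : ∀ c ∈ S, c.1 ≤ S.sup Prod.fst := fun c hc => Finset.le_sup (f := Prod.fst) hc
  have hmem : ∀ c, 1 < (f c).card → c ∈ S := fun c hc => by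
    obtain ⟨x, hx⟩ := Finset.card_pos.1 (zero_lt_one.trans hc)
    exact hf.mem_of_mem hx
  have hb : ∀ r, (∃ k, 1 < (f (r, k)).card) → r ≤ S.sup Prod.fst :=
    fun r ⟨k, hk⟩ => hR _ (hmem _ hk)
  obtain ⟨⟨r0, k0⟩, hc⟩ := hc
  obtain ⟨r, ⟨k, hk⟩, hmax⟩ : ∃ r, (∃ k, 1 < (f (r, k)).card) ∧
      ∀ s, (∃ k, 1 < (f (s, k)).card) → s ≤ r :=
    ⟨Nat.findGreatest (fun r => ∃ k, 1 < (f (r, k)).card) (S.sup Prod.fst),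
      Nat.findGreatest_spec (P := fun r => ∃ k, 1 < (f (r, k)).card) (hb r0 ⟨k0, hc⟩) ⟨k0, hc⟩,
      fun s hs => Nat.le_findGreatest (hb s hs) hs⟩
  refine ⟨(r, k), hk, ?_⟩
  have hne : (f (r, k)).Nonempty := Finset.card_pos.1 (zero_lt_one.trans hk)
  obtain ⟨w, hw, hwy⟩ := Finset.exists_mem_ne hk ((f (r, k)).max' hne)
  refine exists_push_down hS hl he P (S.sup Prod.fst + 1) r k ((f (r, k)).max' hne) f
    (fun c hc => by have := hR c hc; omega) hf (Finset.max'_mem _ _)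
    (fun x hx => Finset.le_max' _ _ hx) ⟨w, hw, hwy⟩ ?_ (fun i hi s => (hP i hi s).trans (by omega))
  intro c x z hc hx hz
  by_contra hxz
  have := hmax c.1 ⟨c.2, Finset.one_lt_card.2 ⟨x, hx, z, hz, hxz⟩⟩
  omega

/-- The bumping process that moves an entry of a box with several entries to higher rows, until
it creates a new box at the beginning of a row. -/
theorem exists_push_up (hS : ∀ i j, (i, j) ∈ S ↔ l i ≤ j ∧ j < e i) (hl : Antitone l)
    (he : Antitone e) (r : ℕ) :
    ∀ (j y : ℕ) (f : ℕ × ℕ → Finset ℕ), IsTab S f → y ∈ f (r, j) →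
    (∀ x ∈ f (r, j), y ≤ x) → (∃ x ∈ f (r, j), x ≠ y) → y < r →
    (∀ c x z, c.1 < r → x ∈ f c → z ∈ f c → x = z) →
    (∀ i s, topCount S f (s + 1) (i + 1) ≤
      topCount S f s i + if s = r ∧ i = y then 1 else 0) →
    ∃ t, l (t + 1) < l t ∧ ∃ f', IsTab (insert (t, l t - 1) S) f' ∧
      (∀ i, IsLatticeAt (insert (t, l t - 1) S) f' i) ∧
      ∀ i, totalCount (insert (t, l t - 1) S) f' i = totalCount S f i := by
  classical
  have hconv := isConvex_of_rows hS hl he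
  induction r with
  | zero =>
    intro j y f hf _ _ _ hy
    omega
  | succ r ih =>
    intro j y f hf hy hmin hw hyr hsing hinv
    obtain ⟨w, hw, hwy⟩ := hw
    have hwlt : y < w := lt_of_le_of_ne (hmin w hw) hwy.symm
    have hrj := (hS _ _).1 (hf.mem_of_mem hy)
    have hprev : (r, j) ∈ S ∨ j < l r := by
      rw [hS]
      have := he (Nat.le_succ r)
      simp only [Nat.succ_eq_add_one] at this
      omega
    have hno : ∀ i, i + 1 = y → (∀ m, i ∉ f (r, m)) →
        topCount S f (r + 1) (i + 1) + 1 ≤ topCount S f r i := by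
      rintro i rfl h
      have h0 : boxCount S f (fun c => c.1 = r) i = 0 := by
        refine boxCount_eq_zero ?_
        rintro ⟨i, m⟩ - hi
        obtain rfl : i = r := hi
        exact h m
      have h1 := topCount_succ (S := S) (f := f) r i
      have h2 := topCount_succ (S := S) (f := f) (r + 1) (i + 1)
      have h3 : 0 < boxCount S f (fun c => c.1 = r + 1) (i + 1) :=
        boxCount_pos (hf.mem_of_mem hy) rfl hy
      have h4 := hinv i (r + 1)
      rw [if_neg (by omega)] at h4
      omega
    have hbelow : ∀ m, j ≤ m → ∀ a ∈ eraseAt f (r + 1, j) y (r + 1, m), y < a := by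
      intro m hm a ha
      rw [mem_eraseAt] at ha
      rcases hm.eq_or_lt with rfl | hm
      · exact lt_of_le_of_ne (hmin a ha.1) fun h => ha.2 ⟨rfl, h.symm⟩
      · exact hwlt.trans_le (hf.row_le hconv hm hw ha.1)
    have hf1 := hf.eraseAt hw hwy
    have hsub : ∀ {c x}, x ∈ eraseAt f (r + 1, j) y c → x ∈ f c := fun h => (mem_eraseAt.1 h).1
    by_cases hex : ∃ m, ∃ z ∈ f (r, m), z < y
    · have hb : ∀ m, (∃ z ∈ f (r, m), z < y) → m ≤ e r := fun m ⟨z, hz, _⟩ =>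
        ((hS _ _).1 (hf.mem_of_mem hz)).2.le
      obtain ⟨m, ⟨z, hz, hyz⟩, hmax⟩ : ∃ m, (∃ z ∈ f (r, m), z < y) ∧
          ∀ k, (∃ z ∈ f (r, k), z < y) → k ≤ m := by
        obtain ⟨m, hm⟩ := hex
        exact ⟨Nat.findGreatest (fun m => ∃ z ∈ f (r, m), z < y) (e r),
          Nat.findGreatest_spec (P := fun m => ∃ z ∈ f (r, m), z < y) (hb m hm) hm,
          fun k hk => Nat.le_findGreatest (hb k hk) hk⟩
      have hzS := hf.mem_of_mem hz
      have hmj : j ≤ m := by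
        rcases hprev with h | h
        · obtain ⟨x, hx⟩ := hf.nonempty _ h
          exact hmax j ⟨x, hx, hf.col hx hy⟩
        · have := (hS _ _).1 hzS
          omega
      have hynot : y ∉ f (r, m) := fun h => hyz.ne (hsing _ _ _ (by simp) hz h)
      have hf2 := hf1.addAt (r := r) (k := m) (y := y)
        (fun k hk a ha => by
          subst hk
          exact (hf.row (hsub ha) hz).trans hyz.le)
        (fun a ha => by
          by_contra! hlt
          have := hmax _ ⟨a, hsub ha, hlt⟩
          omega)
        (fun i hi a ha => by
          subst hi
          exact (hf.col (hsub ha) hz).trans hyz)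
        (hbelow m hmj)
      have hcount := boxCount_move hf hy hynot
      rw [Finset.insert_eq_of_mem hzS] at hf2 hcount
      have key := ih m z _ hf2 (mem_addAt.2 (Or.inl (mem_eraseAt.2 ⟨hz, by simp⟩))) ?_
        ⟨y, mem_addAt.2 (by tauto), hyz.ne'⟩ (by omega) ?_ ?_
      · obtain ⟨t, het, f', hf', hP, htot⟩ := key
        refine ⟨t, het, f', hf', hP, fun i => ?_⟩
        have := hcount (fun _ => True) i
        rw [htot i, totalCount, totalCount]
        omega
      · intro x hx
        rw [mem_addAt] at hx
        rcases hx with hx | ⟨-, rfl⟩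
        · exact (hsing _ _ _ (by simp) hz (hsub hx)).le
        · exact hyz.le
      · intro c x x' hc hx hx'
        rw [mem_addAt] at hx hx'
        rcases hx with hx | ⟨rfl, -⟩
        · rcases hx' with hx' | ⟨rfl, -⟩
          · exact hsing c x x' (by omega) (hsub hx) (hsub hx')
          · simp at hc
        · simp at hc
      · intro i s
        have h1 := hcount (fun c => c.1 < s + 1) (i + 1)
        have h2 := hcount (fun c => c.1 < s) i
        have h3 := hinv i s
        dsimp only at h1 h2
        simp only [topCount] at h3 hno ⊢
        by_cases hiy : i + 1 = y
        · have hne : i ≠ y := by omega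
          simp only [hiy, hne, and_true, and_false, if_false, add_zero] at h1 h2 h3 ⊢
          rcases lt_trichotomy s r with hs | rfl | hs
          · rw [if_neg (by omega), if_neg (by omega)] at h1
            rw [if_neg (by omega)]
            omega
          · rw [if_neg (by omega), if_pos (by omega)] at h1
            by_cases hz1 : i = z
            · rw [if_pos ⟨rfl, hz1⟩]
              omega
            · rw [if_neg (by omega)]
              have := hno i hiy (fun k hk => ?_)
              · rw [hiy] at this
                omega
              · have hkm := hmax k ⟨i, hk, by omega⟩
                rcases hkm.eq_or_lt with rfl | hkm
                · exact hz1 (hsing _ _ _ (by simp) hk hz)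
                · have := hf.row_le hconv hkm hk hz
                  omega
          · rw [if_pos (by omega), if_pos (by omega)] at h1
            rw [if_neg (by omega)]
            omega
        · simp only [hiy, and_false, if_false, add_zero] at h1
          split_ifs at h2 h3 <;> omega
    · push Not at hex
      have hej : j < l r := by
        rcases hprev with h | h
        · obtain ⟨x, hx⟩ := hf.nonempty _ h
          have h1 := hf.col hx hy
          have h2 := hex j x hx
          omega
        · exact h
      have hynot : y ∉ f (r, l r - 1) := fun h => by
        have := (hS _ _).1 (hf.mem_of_mem h)
        omega
      have hf2 := hf1.addAt (r := r) (k := l r - 1) (y := y)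
        (fun k _ a ha => by
          have := (hS _ _).1 (hf1.mem_of_mem ha)
          omega)
        (fun a ha => hex _ a (hsub ha))
        (fun i hi a ha => by
          have h1 := (hS _ _).1 (hf1.mem_of_mem ha)
          have h2 := hl (show i ≤ r by omega)
          omega)
        (hbelow _ (by omega))
      have hcount := boxCount_move hf hy hynot
      refine ⟨r, by omega, _, hf2, fun i s => ?_, fun i => ?_⟩
      · have h1 := hcount (fun c => c.1 < s + 1) (i + 1)
        have h2 := hcount (fun c => c.1 < s) i
        have h3 := hinv i s
        dsimp only at h1 h2
        simp only [topCount] at h3 hno ⊢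
        by_cases hiy : i + 1 = y
        · have hne : i ≠ y := by omega
          have h4 := hno i hiy (fun k hk => by have := hex k _ hk; omega)
          simp only [hiy, hne, and_true, and_false, if_false, add_zero] at h1 h2 h3 h4 ⊢
          rcases lt_trichotomy s r with hs | rfl | hs
          · rw [if_neg (by omega), if_neg (by omega)] at h1
            omega
          · rw [if_neg (by omega), if_pos (by omega)] at h1
            omega
          · rw [if_pos (by omega), if_pos (by omega)] at h1
            omega
        · simp only [hiy, and_false, if_false, add_zero] at h1
          split_ifs at h2 h3 <;> omega
      · have := hcount (fun _ => True) i
        rw [totalCount, totalCount]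
        omega

/-- In a tableau that is lattice for the letters up to `m`, the entry `m` occurs only in rows
`≥ m`. -/
theorem le_row_of_isLatticeAt {f : ℕ × ℕ → Finset ℕ} (hf : IsTab S f) {m : ℕ}
    (hlat : ∀ i < m, IsLatticeAt S f i) {c : ℕ × ℕ} (hm : m ∈ f c) : m ≤ c.1 := by
  have key : ∀ m, (∀ i < m, IsLatticeAt S f i) → ∀ s, 0 < topCount S f s m → m < s := by
    intro m
    induction m with
    | zero =>
      intro _ s hs
      rcases s.eq_zero_or_pos with rfl | h
      · rw [topCount_zero] at hs
        omega
      · exact h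
    | succ m ih =>
      intro hlat s hs
      rcases s with - | s
      · rw [topCount_zero] at hs
        omega
      · have h1 := hlat m (by omega) s
        have := ih (fun i hi => hlat i (by omega)) s (by omega)
        omega
  exact Nat.lt_succ_iff.1 (key m hlat (c.1 + 1)
    (boxCount_pos (hf.mem_of_mem hm) (Nat.lt_succ_self _) hm))

theorem row_le_of_mem {f : ℕ × ℕ → Finset ℕ} (hf : IsTab S f) {r k : ℕ}
    (hS : ∀ i ≤ r, (i, k) ∈ S) : ∀ x ∈ f (r, k), r ≤ x := by
  induction r with
  | zero => simp
  | succ r ih =>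
    intro x hx
    obtain ⟨y, hy⟩ := hf.nonempty (r, k) (hS r (by omega))
    have h1 := ih (fun i hi => hS i (by omega)) y hy
    have h2 := hf.col hy hx
    omega

/-- If some box has several entries, a box can be added at the beginning of a row while keeping
the content. -/
theorem exists_add_box_above (hS : ∀ i j, (i, j) ∈ S ↔ l i ≤ j ∧ j < e i) (hl : Antitone l)
    (he : Antitone e) {f : ℕ × ℕ → Finset ℕ} (hf : IsTab S f)
    (hP : ∀ i, IsLatticeAt S f i) (hc : ∃ c, 1 < (f c).card) :
    ∃ t, l (t + 1) < l t ∧ ∃ f', IsTab (insert (t, l t - 1) S) f' ∧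
      (∀ i, IsLatticeAt (insert (t, l t - 1) S) f' i) ∧
      ∀ i, totalCount (insert (t, l t - 1) S) f' i = totalCount S f i := by
  classical
  obtain ⟨⟨r0, k0⟩, hc⟩ := hc
  have hex : ∃ r, ∃ k, 1 < (f (r, k)).card := ⟨r0, k0, hc⟩
  obtain ⟨r, ⟨k, hk⟩, hmin⟩ : ∃ r, (∃ k, 1 < (f (r, k)).card) ∧
      ∀ s < r, ¬ ∃ k, 1 < (f (s, k)).card :=
    ⟨Nat.find hex, Nat.find_spec hex, fun s hs => Nat.find_min hex hs⟩
  have hne : (f (r, k)).Nonempty := Finset.card_pos.1 (zero_lt_one.trans hk)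
  obtain ⟨w, hw, hwy⟩ := Finset.exists_mem_ne hk ((f (r, k)).min' hne)
  have hlt : (f (r, k)).min' hne < r :=
    (lt_of_le_of_ne (Finset.min'_le _ _ hw) hwy.symm).trans_le
      (le_row_of_isLatticeAt hf (fun i _ => hP i) hw)
  refine exists_push_up hS hl he r k ((f (r, k)).min' hne) f hf (Finset.min'_mem _ _)
    (fun x hx => Finset.min'_le _ _ hx) ⟨w, hw, hwy⟩ hlt ?_
    (fun i s => (hP i s).trans (by omega))
  intro c x z hc hx hz
  by_contra hxz
  exact hmin c.1 hc ⟨c.2, Finset.one_lt_card.2 ⟨x, hx, z, hz, hxz⟩⟩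

end Moves

/-- The box `d` is read after the box `c` in the column reading order. -/
def ReadAfter (c d : ℕ × ℕ) : Prop := c.2 < d.2 ∨ (c.2 = d.2 ∧ d.1 < c.1)

section Reading

theorem count_flatMap_sort {f : ℕ × ℕ → Finset ℕ} (L : List (ℕ × ℕ)) (x : ℕ) :
    (L.flatMap fun c => (f c).sort (· ≤ ·)).count x = L.countP fun c => x ∈ f c := by
  induction L with
  | nil => rfl
  | cons c L ih =>
    rw [List.flatMap_cons, List.count_append, ih, List.countP_cons, add_comm]
    congr 1
    by_cases h : x ∈ f c
    · simp [h]
    · simp [h, List.count_eq_zero_of_not_mem (fun h' => h ((Finset.mem_sort _).1 h'))]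

theorem suffix_count_le_iff {f : ℕ × ℕ → Finset ℕ} (L : List (ℕ × ℕ)) (i : ℕ) :
    (∀ s, s <:+ (L.flatMap fun c => (f c).sort (· ≤ ·)) → s.count (i + 1) ≤ s.count i) ↔
      ∀ L₁ c L₂, L = L₁ ++ c :: L₂ → i + 1 ∈ f c →
        (L₂.countP fun d => i + 1 ∈ f d) + 1 ≤ L₂.countP fun d => i ∈ f d := by
  constructor
  · rintro h L₁ c L₂ rfl hc
    obtain ⟨a, b, hab⟩ := List.append_of_mem ((Finset.mem_sort (· ≤ ·)).2 hc)
    have hb : i ∉ b := by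
      intro hi
      have := (hab ▸ Finset.pairwise_sort (f c) (· ≤ ·) : (a ++ (i + 1) :: b).Pairwise (· ≤ ·))
      have := (List.pairwise_cons.1 (List.pairwise_append.1 this).2.1).1 i hi
      omega
    have := h ((i + 1) :: b ++ L₂.flatMap fun c => (f c).sort (· ≤ ·)) (by
      rw [List.flatMap_append, List.flatMap_cons, hab]
      exact ⟨(L₁.flatMap fun c => (f c).sort (· ≤ ·)) ++ a, by simp⟩)
    rw [List.count_append, List.count_append, count_flatMap_sort, count_flatMap_sort,
      List.count_cons_self, List.count_cons_of_ne (by omega), List.count_eq_zero_of_not_mem hb]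
      at this
    omega
  · induction L with
    | nil =>
      intro _ s hs
      rw [List.flatMap_nil, List.suffix_nil] at hs
      simp [hs]
    | cons c L ih =>
      intro h
      have ih := ih fun L₁ d L₂ hL => h (c :: L₁) d L₂ (by simp [hL])
      rintro s ⟨t, hs⟩
      rw [List.flatMap_cons, List.append_eq_append_iff] at hs
      rcases hs with ⟨a, ha, rfl⟩ | ⟨a, -, ha⟩
      · have hW := ih _ List.suffix_rfl
        rw [List.count_append, List.count_append]
        have hnd : a.Nodup := by
          have := Finset.sort_nodup (f c) (· ≤ ·)
          rw [ha] at this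
          exact this.of_append_right
        by_cases hi : i + 1 ∈ a
        · have := h [] c L rfl ((Finset.mem_sort (· ≤ ·)).1 (by rw [ha]; simp [hi]))
          rw [List.count_eq_one_of_mem hnd hi, count_flatMap_sort, count_flatMap_sort]
          omega
        · rw [List.count_eq_zero_of_not_mem hi]
          omega
      · exact ih s ⟨a, ha.symm⟩

variable {S : Finset (ℕ × ℕ)} {f : ℕ × ℕ → Finset ℕ}

theorem countP_eq_boxCount {L : List (ℕ × ℕ)} (hL : L.Nodup) {p : ℕ × ℕ → Prop} {x : ℕ}
    (h : ∀ c ∈ S, x ∈ f c → (c ∈ L ↔ p c)) (hf : ∀ c, x ∈ f c → c ∈ S) :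
    (L.countP fun c => x ∈ f c) = boxCount S f p x := by
  classical
  rw [boxCount, List.countP_eq_length_filter, ← List.toFinset_card_of_nodup (hL.filter _)]
  congr 1
  ext c
  simp only [List.mem_toFinset, List.mem_filter, decide_eq_true_eq, Finset.mem_filter]
  have := h c
  have := hf c
  tauto

theorem suffix_count_le_iff_boxCount (hf : ∀ {c x}, x ∈ f c → c ∈ S) {L : List (ℕ × ℕ)}
    (hL : L.Pairwise ReadAfter) (hS : ∀ c ∈ S, c ∈ L) (i : ℕ) :
    (∀ s, s <:+ (L.flatMap fun c => (f c).sort (· ≤ ·)) → s.count (i + 1) ≤ s.count i) ↔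
      ∀ c, i + 1 ∈ f c →
        boxCount S f (ReadAfter c) (i + 1) + 1 ≤ boxCount S f (ReadAfter c) i := by
  have key : ∀ L₁ c L₂, L = L₁ ++ c :: L₂ → ∀ x,
      (L₂.countP fun d => x ∈ f d) = boxCount S f (ReadAfter c) x := by
    rintro L₁ c L₂ rfl x
    rw [List.pairwise_append, List.pairwise_cons] at hL
    obtain ⟨-, ⟨h2, h3⟩, h4⟩ := hL
    refine countP_eq_boxCount (h3.imp fun h => ?_) (fun d hd _ => ⟨fun h => h2 d h, fun h => ?_⟩)
      fun _ => hf
    · rintro rfl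
      simp [ReadAfter] at h
    · have := hS d hd
      rw [List.mem_append, List.mem_cons] at this
      rcases this with h' | rfl | h'
      · have := h4 d h' c (by simp)
        unfold ReadAfter at this h
        omega
      · simp [ReadAfter] at h
      · exact h'
  rw [suffix_count_le_iff]
  constructor
  · intro h c hc
    obtain ⟨L₁, L₂, hL'⟩ := List.append_of_mem (hS c (hf hc))
    rw [← key L₁ c L₂ hL', ← key L₁ c L₂ hL']
    exact h L₁ c L₂ hL' hc
  · intro h L₁ c L₂ hL' hc
    rw [key L₁ c L₂ hL', key L₁ c L₂ hL']
    exact h c hc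

theorem boxCount_eq_one {c : ℕ × ℕ} {x : ℕ} (hc : c ∈ S) (hx : x ∈ f c) :
    boxCount S f (fun d => d = c) x = 1 := by
  classical
  rw [boxCount, Finset.card_eq_one]
  refine ⟨c, ?_⟩
  ext d
  simp only [Finset.mem_filter, Finset.mem_singleton]
  exact ⟨fun h => h.2.1, by rintro rfl; exact ⟨hc, rfl, hx⟩⟩

theorem isLatticeAt_of_boxCount_readAfter (hS : IsConvex S) (hf : IsTab S f) {i : ℕ}
    (h : ∀ c, i + 1 ∈ f c →
      boxCount S f (ReadAfter c) (i + 1) + 1 ≤ boxCount S f (ReadAfter c) i) :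
    IsLatticeAt S f i := by
  classical
  have hrow : ∀ r, (∃ k, i + 1 ∈ f (r, k)) →
      topCount S f (r + 1) (i + 1) ≤ topCount S f r i := by
    intro r hex
    obtain ⟨k, hk, hmin⟩ : ∃ k, i + 1 ∈ f (r, k) ∧ ∀ m < k, i + 1 ∉ f (r, m) :=
      ⟨Nat.find hex, Nat.find_spec hex, fun m hm => Nat.find_min hex hm⟩
    have h1 : topCount S f (r + 1) (i + 1) =
        boxCount S f (fun c => c = (r, k)) (i + 1) +
          boxCount S f (fun c => c.1 < r + 1 ∧ c ≠ (r, k)) (i + 1) := by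
      refine boxCount_add_of_split (fun c _ _ => ⟨by tauto, ?_⟩) (by tauto)
      rintro (rfl | h)
      · simp
      · exact h.1
    have h2 : boxCount S f (fun c => c.1 < r + 1 ∧ c ≠ (r, k)) (i + 1) ≤
        boxCount S f (ReadAfter (r, k)) (i + 1) := by
      refine boxCount_mono ?_
      rintro ⟨r', k'⟩ hc ⟨h1, h2⟩ h3
      refine ⟨?_, h3⟩
      dsimp only at h1
      simp only [ReadAfter]
      rcases (Nat.lt_succ_iff.1 h1).eq_or_lt with rfl | h1
      · rcases lt_trichotomy k' k with h | rfl | h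
        · exact absurd h3 (hmin _ h)
        · exact absurd rfl h2
        · exact Or.inl h
      · by_contra h4
        have := hf.lt_of_lt_of_le hS h1 (show k' ≤ k by omega) h3 hk
        omega
    have h3 : boxCount S f (ReadAfter (r, k)) i ≤ topCount S f r i := by
      refine boxCount_mono ?_
      rintro ⟨r', k'⟩ hc h1 h3
      refine ⟨?_, h3⟩
      simp only [ReadAfter] at h1
      by_contra! h4
      dsimp only at h4
      have h5 : k < k' := by omega
      rcases h4.eq_or_lt with rfl | h4
      · have := hf.row_le hS h5 hk h3
        omega
      · have := hf.lt_of_lt_of_le hS h4 h5.le hk h3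
        omega
    have h4 := boxCount_eq_one (hf.mem_of_mem hk) hk
    have := h _ hk
    omega
  intro r
  by_cases hex : ∃ k, i + 1 ∈ f (r, k)
  · exact hrow r hex
  have h0 : ∀ r, (¬ ∃ k, i + 1 ∈ f (r, k)) → boxCount S f (fun c => c.1 = r) (i + 1) = 0 := by
    intro r hex
    refine boxCount_eq_zero ?_
    rintro ⟨a, m⟩ - hi
    obtain rfl : a = r := hi
    exact not_exists.1 hex m
  induction r with
  | zero =>
    rw [topCount_succ, h0 0 hex, topCount_zero]
    omega
  | succ r ih =>
    rw [topCount_succ, h0 _ hex, add_zero, topCount_succ r i]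
    by_cases hex' : ∃ k, i + 1 ∈ f (r, k)
    · exact (hrow r hex').trans (Nat.le_add_right _ _)
    · exact (ih hex').trans (Nat.le_add_right _ _)

theorem boxCount_readAfter_of_isLatticeAt (hS : IsConvex S) (hf : IsTab S f) {i : ℕ}
    (h : IsLatticeAt S f i) {c : ℕ × ℕ} (hk : i + 1 ∈ f c) :
    boxCount S f (ReadAfter c) (i + 1) + 1 ≤ boxCount S f (ReadAfter c) i := by
  obtain ⟨r, k⟩ := c
  have h1 : topCount S f (r + 1) (i + 1) =
      boxCount S f (fun c => c = (r, k) ∨ ReadAfter (r, k) c) (i + 1) +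
        boxCount S f (fun c => c.1 = r ∧ c.2 < k) (i + 1) := by
    refine boxCount_add_of_split ?_ ?_
    · rintro ⟨r', k'⟩ - hx
      simp only [ReadAfter, Prod.mk.injEq]
      constructor
      · intro hr
        by_contra! hn
        have := hf.lt_of_lt_of_le hS (show r' < r by omega) (show k' ≤ k by omega) hx hk
        omega
      · intro hr
        by_contra! hn
        have := hf.lt_of_lt_of_le hS (show r < r' by omega) (show k ≤ k' by omega) hk hx
        omega
    · rintro ⟨r', k'⟩ - -
      simp only [ReadAfter, Prod.mk.injEq]
      omega
  have h2 : boxCount S f (fun c => c = (r, k) ∨ ReadAfter (r, k) c) (i + 1) =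
      boxCount S f (fun c => c = (r, k)) (i + 1) + boxCount S f (ReadAfter (r, k)) (i + 1) := by
    refine boxCount_add_of_split (fun _ _ _ => Iff.rfl) ?_
    rintro _ - - rfl
    simp [ReadAfter]
  have h3 : topCount S f r i =
      boxCount S f (fun c => c.1 < r ∧ k ≤ c.2) i +
        boxCount S f (fun c => c.1 < r ∧ c.2 < k) i :=
    boxCount_add_of_split (fun c _ _ => by omega) (fun c _ _ => by omega)
  have h4 : boxCount S f (fun c => c.1 < r ∧ k ≤ c.2) i ≤ boxCount S f (ReadAfter (r, k)) i := by
    refine boxCount_mono fun c _ hc hx => ⟨?_, hx⟩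
    simp only [ReadAfter]
    omega
  have h5 : boxCount S f (fun c => c.1 < r ∧ c.2 < k) i ≤
      boxCount S f (fun c => c.1 = r ∧ c.2 < k) (i + 1) := by
    refine boxCount_le_of_shift (fun c => (r, c.2)) ?_ ?_
    · rintro ⟨r', k'⟩ hc ⟨hr, hk'⟩ hx
      dsimp only at hr hk'
      have hmem : (r, k') ∈ S := hS _ hc _ (hf.mem_of_mem hk) _ ⟨hr.le, le_rfl⟩ ⟨le_rfl, hk'.le⟩
      obtain ⟨z, hz⟩ := hf.nonempty _ hmem
      have h6 := hf.col_lt hS hr hx hz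
      have h7 := hf.row_le hS hk' hz hk
      obtain rfl : z = i + 1 := by omega
      exact ⟨hmem, ⟨rfl, hk'⟩, hz⟩
    · rintro ⟨r', k'⟩ - - hx ⟨r'', k''⟩ - - hx' heq
      obtain rfl : k' = k'' := (Prod.mk.inj heq).2
      rcases lt_trichotomy r' r'' with hr | rfl | hr
      · exact absurd (hf.col_lt hS hr hx hx') (lt_irrefl _)
      · rfl
      · exact absurd (hf.col_lt hS hr hx' hx) (lt_irrefl _)
  have h6 := boxCount_eq_one (hf.mem_of_mem hk) hk
  have := h r
  omega

theorem suffix_count_le_iff_isLatticeAt (hS : IsConvex S) (hf : IsTab S f) {L : List (ℕ × ℕ)}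
    (hL : L.Pairwise ReadAfter) (hSL : ∀ c ∈ S, c ∈ L) (i : ℕ) :
    (∀ s, s <:+ (L.flatMap fun c => (f c).sort (· ≤ ·)) → s.count (i + 1) ≤ s.count i) ↔
      IsLatticeAt S f i := by
  rw [suffix_count_le_iff_boxCount hf.mem_of_mem hL hSL]
  exact ⟨isLatticeAt_of_boxCount_readAfter hS hf,
    fun h _ hc => boxCount_readAfter_of_isLatticeAt hS hf h hc⟩

end Reading

namespace SVT

variable {cells : Finset (ℕ × ℕ)}

theorem mem_cells_of_mem (T : SVT cells) {c : ℕ × ℕ} {x : ℕ} (hx : x ∈ T.entry c) :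
    c ∈ cells := by
  by_contra h
  rw [T.eq_empty_of_not_mem c h] at hx
  simp at hx

theorem isTab (T : SVT cells) : IsTab cells T.entry where
  nonempty := T.nonempty_of_mem
  mem_of_mem := T.mem_cells_of_mem
  row {i j a b} ha hb :=
    T.row_weak i j (T.mem_cells_of_mem ha) (T.mem_cells_of_mem hb) a ha b hb
  col {i j a b} ha hb :=
    T.col_strict i j (T.mem_cells_of_mem ha) (T.mem_cells_of_mem hb) a ha b hb

/-- The set-valued tableau with a given entry function. -/
def ofIsTab {f : ℕ × ℕ → Finset ℕ} (hf : IsTab cells f) : SVT cells where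
  entry := f
  nonempty_of_mem := hf.nonempty
  eq_empty_of_not_mem _ hc := Finset.eq_empty_of_forall_notMem fun _ hx => hc (hf.mem_of_mem hx)
  row_weak _ _ _ _ _ ha _ hb := hf.row ha hb
  col_strict _ _ _ _ _ ha _ hb := hf.col ha hb

/-- The boxes of a square, in the column reading order. -/
def readingList (n : ℕ) : List (ℕ × ℕ) :=
  (List.range n).flatMap fun j => (List.range n).reverse.map fun i => (i, j)

theorem mem_readingList {n : ℕ} {c : ℕ × ℕ} : c ∈ readingList n ↔ c.1 < n ∧ c.2 < n := by
  obtain ⟨i, j⟩ := c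
  simp [readingList, and_comm]

theorem pairwise_readingList (n : ℕ) : (readingList n).Pairwise ReadAfter := by
  rw [readingList, List.pairwise_flatMap]
  constructor
  · intro j _
    rw [List.pairwise_map, List.pairwise_reverse]
    exact List.pairwise_lt_range.imp fun h => Or.inr ⟨rfl, h⟩
  · refine List.pairwise_lt_range.imp fun {j k} h => ?_
    simp only [List.mem_map]
    rintro _ ⟨i, -, rfl⟩ _ ⟨m, -, rfl⟩
    exact Or.inl h

theorem word_eq (T : SVT cells) :
    T.word = (readingList ((cells.sup fun c => max c.1 c.2) + 1)).flatMap
      fun c => (T.entry c).sort (· ≤ ·) := by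
  simp only [word, readingList, List.flatMap_assoc, List.flatMap_map]

theorem mem_readingList_of_mem {c : ℕ × ℕ} (hc : c ∈ cells) :
    c ∈ readingList ((cells.sup fun c => max c.1 c.2) + 1) := by
  rw [mem_readingList]
  have := Finset.le_sup (f := fun c : ℕ × ℕ => max c.1 c.2) hc
  omega

theorem count_word (T : SVT cells) (i : ℕ) : T.word.count i = totalCount cells T.entry i := by
  rw [word_eq, count_flatMap_sort]
  exact countP_eq_boxCount
    ((pairwise_readingList _).imp fun {a b} h => by rintro rfl; simp [ReadAfter] at h)
    (fun c hc _ => by simp [mem_readingList_of_mem hc]) fun _ => T.isTab.mem_of_mem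

theorem suffix_word_count_le_iff (h : IsConvex cells) (T : SVT cells) (i : ℕ) :
    (∀ s, s <:+ T.word → s.count (i + 1) ≤ s.count i) ↔ IsLatticeAt cells T.entry i := by
  rw [word_eq]
  exact suffix_count_le_iff_isLatticeAt h T.isTab (pairwise_readingList _)
    (fun _ => mem_readingList_of_mem) i

theorem isRLW_word_iff (h : IsConvex cells) (T : SVT cells) :
    IsRLW T.word ↔ ∀ i, IsLatticeAt cells T.entry i := by
  simp only [← suffix_word_count_le_iff h T, IsRLW]
  exact ⟨fun H i s hs => H s hs i, fun H s hs i => H i s hs⟩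

theorem isPartialRLW_word_iff (h : IsConvex cells) (T : SVT cells) (a b : ℕ) :
    IsPartialRLW a b T.word ↔ ∀ t, a ≤ t → t + 1 < b → IsLatticeAt cells T.entry t := by
  simp only [← suffix_word_count_le_iff h T, IsPartialRLW]
  exact ⟨fun H i h1 h2 s hs => H s hs i h1 h2, fun H s hs i h1 h2 => H i h1 h2 s hs⟩

theorem finite_bounded (M : ℕ) : {T : SVT cells | T.Bounded M}.Finite := by
  classical
  let F : SVT cells → (cells → Finset ℕ) := fun T c => T.entry c
  have hinj : Function.Injective F := by
    intro T U h
    have : T.entry = U.entry := by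
      funext c
      by_cases hc : c ∈ cells
      · exact congrFun h ⟨c, hc⟩
      · rw [T.eq_empty_of_not_mem c hc, U.eq_empty_of_not_mem c hc]
    cases T
    cases U
    simp_all
  refine Set.Finite.of_finite_image (f := F) ?_ hinj.injOn
  refine (Set.Finite.pi' (t := fun _ : cells => ((Finset.range M).powerset : Set (Finset ℕ)))
    fun _ => Finset.finite_toSet _).subset ?_
  rintro _ ⟨T, hT, rfl⟩ c
  simp only [Finset.coe_powerset, Set.mem_preimage, Set.mem_powerset_iff]
  intro x hx
  simpa using hT _ x hx

theorem natCard_ne_zero_iff {Q : SVT cells → Prop} (M : ℕ) (hQ : ∀ T, Q T → T.Bounded M) :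
    Nat.card {T : SVT cells // Q T} ≠ 0 ↔ ∃ T, Q T := by
  have : Finite {T : SVT cells // Q T} := ((finite_bounded M).subset hQ).to_subtype
  rw [Nat.card_ne_zero, nonempty_subtype]
  exact and_iff_left this

theorem bounded_of_count (T : SVT cells) {M : ℕ} (h : ∀ i, M ≤ i → T.word.count i = 0) :
    T.Bounded M := by
  intro c x hx
  by_contra! hM
  have := h x hM
  rw [count_word] at this
  exact (boxCount_pos (T.isTab.mem_of_mem hx) trivial hx).ne' this

end SVT

namespace YoungDiagram

theorem rowLen_eq_of_mem_iff {mu : YoungDiagram} {i n : ℕ} (h : ∀ j, (i, j) ∈ mu ↔ j < n) :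
    mu.rowLen i = n := by
  simp only [mem_iff_lt_rowLen] at h
  have h1 := h n
  have h2 := h (mu.rowLen i)
  omega

theorem lt_colLen_zero_iff {mu : YoungDiagram} {i : ℕ} : i < mu.colLen 0 ↔ 0 < mu.rowLen i := by
  rw [← mem_iff_lt_colLen, mem_iff_lt_rowLen]

theorem rowLen_eq_zero {mu : YoungDiagram} {i : ℕ} (h : mu.colLen 0 ≤ i) : mu.rowLen i = 0 := by
  have := lt_colLen_zero_iff (mu := mu) (i := i)
  omega

theorem antitone_rowLen (mu : YoungDiagram) : Antitone mu.rowLen :=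
  fun _ _ h => mu.rowLen_anti _ _ h

theorem sum_rowLen (mu : YoungDiagram) {M : ℕ} (hM : mu.colLen 0 ≤ M) :
    ∑ i ∈ Finset.range M, mu.rowLen i = mu.card := by
  rw [YoungDiagram.card, Finset.card_eq_sum_card_fiberwise (f := Prod.fst) (t := Finset.range M)]
  · exact Finset.sum_congr rfl fun i _ => mu.rowLen_eq_card
  · rintro ⟨i, j⟩ hc
    have h1 := mem_iff_lt_colLen.1 (mu.up_left_mem le_rfl (Nat.zero_le j) hc)
    simp only [Finset.coe_range, Set.mem_Iio]
    omega

/-- Adding a corner at the end of row `t + 1`. -/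
theorem exists_insert_corner (mu : YoungDiagram) {t : ℕ} (h : mu.rowLen (t + 1) < mu.rowLen t) :
    ∃ mt : YoungDiagram, mu ≤ mt ∧ mt.card = mu.card + 1 ∧
      mt.cells = insert (t + 1, mu.rowLen (t + 1)) mu.cells := by
  refine ⟨⟨insert (t + 1, mu.rowLen (t + 1)) mu.cells, ?_⟩, ?_, ?_, rfl⟩
  · rintro ⟨i, j⟩ ⟨i', j'⟩ ⟨h1, h2⟩ h3
    simp only [Finset.coe_insert, Set.mem_insert_iff, Prod.mk.injEq, Finset.mem_coe, mem_cells,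
      mem_iff_lt_rowLen] at h1 h2 h3 ⊢
    rcases h3 with ⟨rfl, rfl⟩ | h3
    · rcases h1.eq_or_lt with rfl | h1
      · omega
      · have := mu.rowLen_anti i' t (by omega)
        omega
    · have := mu.rowLen_anti _ _ h1
      omega
  · exact cells_subset_iff.1 (Finset.subset_insert _ _)
  · exact Finset.card_insert_of_notMem (by simp [mem_iff_lt_rowLen])

/-- Removing the corner at the end of row `b`. -/
theorem exists_erase_corner (mu : YoungDiagram) {b : ℕ} (h : mu.rowLen (b + 1) < mu.rowLen b) :
    ∃ mt : YoungDiagram, mt ≤ mu ∧ mt.card + 1 = mu.card ∧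
      mt.cells = mu.cells.erase (b, mu.rowLen b - 1) ∧
      ∀ i, mt.rowLen i + (if i = b then 1 else 0) = mu.rowLen i := by
  have hlower : IsLowerSet (mu.cells.erase (b, mu.rowLen b - 1) : Set (ℕ × ℕ)) := by
    rintro ⟨i, j⟩ ⟨i', j'⟩ ⟨h1, h2⟩ h3
    simp only [Finset.coe_erase, Set.mem_sdiff, Set.mem_singleton_iff, Prod.mk.injEq,
      Finset.mem_coe, mem_cells, mem_iff_lt_rowLen] at h1 h2 h3 ⊢
    have := mu.rowLen_anti _ _ h1
    refine ⟨by omega, ?_⟩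
    rintro ⟨rfl, rfl⟩
    rcases h1.eq_or_lt with rfl | h1
    · omega
    · have := mu.rowLen_anti (i' + 1) i h1
      omega
  refine ⟨⟨_, hlower⟩, cells_subset_iff.1 (Finset.erase_subset _ _),
    Finset.card_erase_add_one ?_, rfl, fun i => ?_⟩
  · simp only [mem_cells, mem_iff_lt_rowLen]
    omega
  · have key : rowLen ⟨_, hlower⟩ i = mu.rowLen i - if i = b then 1 else 0 := by
      refine rowLen_eq_of_mem_iff fun j => ?_
      rw [mem_mk]
      simp only [Finset.mem_erase, ne_eq, Prod.mk.injEq, mem_cells, mem_iff_lt_rowLen]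
      split_ifs with hi
      · subst hi
        omega
      · simp [hi]
    rw [key]
    split_ifs with hi
    · subst hi
      omega
    · omega

end YoungDiagram

section Coefficients

variable {S : Finset (ℕ × ℕ)} {f : ℕ × ℕ → Finset ℕ}

theorem exists_one_lt_card {M : ℕ} (hM : ∀ i, M ≤ i → totalCount S f i = 0)
    (h : S.card < ∑ i ∈ Finset.range M, totalCount S f i) : ∃ c, 1 < (f c).card := by
  by_contra! hc
  rw [sum_totalCount] at h
  · have := Finset.sum_le_card_nsmul S (fun c => (f c).card) 1 fun c _ => hc c
    rw [smul_eq_mul, mul_one] at this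
    omega
  · intro c hc x hx
    by_contra! hx'
    exact (boxCount_pos hc trivial hx).ne' (hM x hx')

theorem exists_one_lt_card_of_content {mu : YoungDiagram}
    (hc : ∀ i, totalCount S f i = mu.rowLen i) (h : S.card < mu.card) :
    ∃ c, 1 < (f c).card := by
  refine exists_one_lt_card (S := S) (M := mu.colLen 0) (fun i hi => ?_) ?_
  · rw [hc, YoungDiagram.rowLen_eq_zero hi]
  · simp only [hc]
    rwa [mu.sum_rowLen le_rfl]

theorem isLatticeAt_totalCount_le {i : ℕ} (h : IsLatticeAt S f i) :
    totalCount S f (i + 1) ≤ totalCount S f i := by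
  have h1 : totalCount S f (i + 1) ≤ topCount S f (S.sup Prod.fst + 1 + 1) (i + 1) := by
    refine boxCount_mono fun c hc _ hx => ⟨?_, hx⟩
    have := Finset.le_sup (f := Prod.fst) hc
    omega
  exact h1.trans ((h _).trans (boxCount_mono fun _ _ _ hx => ⟨trivial, hx⟩))

theorem neg_one_pow_mul_natCard_ne_zero_iff {n m : ℕ} :
    (-1 : ℤ) ^ n * (m : ℤ) ≠ 0 ↔ m ≠ 0 := by
  simp

theorem natCard_isRLW_ne_zero_iff (hS : IsConvex S) (mu : YoungDiagram) :
    Nat.card {T : SVT S // IsRLW T.word ∧ HasContent T.word mu} ≠ 0 ↔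
      ∃ f, IsTab S f ∧ (∀ i, IsLatticeAt S f i) ∧ ∀ i, totalCount S f i = mu.rowLen i := by
  rw [SVT.natCard_ne_zero_iff (mu.colLen 0) fun T hT => T.bounded_of_count fun i hi => by
    rw [hT.2, YoungDiagram.rowLen_eq_zero hi]]
  simp only [SVT.isRLW_word_iff hS, HasContent, SVT.count_word]
  exact ⟨fun ⟨T, hT⟩ => ⟨T.entry, T.isTab, hT⟩, fun ⟨f, hf, h⟩ => ⟨SVT.ofIsTab hf, h⟩⟩

theorem alphaCoeff_ne_zero_iff (hS : IsConvex S) (mu : YoungDiagram) :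
    alphaCoeff S mu ≠ 0 ↔
      ∃ f, IsTab S f ∧ (∀ i, IsLatticeAt S f i) ∧ ∀ i, totalCount S f i = mu.rowLen i := by
  rw [alphaCoeff, neg_one_pow_mul_natCard_ne_zero_iff, natCard_isRLW_ne_zero_iff hS]

theorem mem_starCells {lam mu : YoungDiagram} (i j : ℕ) :
    (i, j) ∈ starCells lam mu ↔
      (if i < lam.colLen 0 then mu.rowLen 0 else 0) ≤ j ∧
      j < if i < lam.colLen 0 then mu.rowLen 0 + lam.rowLen i else mu.rowLen (i - lam.colLen 0) := by
  simp only [starCells, Finset.mem_union, Finset.mem_image, YoungDiagram.mem_cells, Prod.exists,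
    Prod.mk.injEq, YoungDiagram.mem_iff_lt_rowLen]
  split_ifs with h
  · constructor
    · rintro (⟨a, b, h1, rfl, rfl⟩ | ⟨a, b, h1, rfl, rfl⟩) <;> omega
    · rintro ⟨h1, h2⟩
      exact Or.inl ⟨i, j - mu.rowLen 0, by omega, rfl, by omega⟩
  · constructor
    · rintro (⟨a, b, h1, rfl, rfl⟩ | ⟨a, b, h1, rfl, rfl⟩)
      · have := YoungDiagram.lt_colLen_zero_iff (mu := lam) (i := a)
        omega
      · rw [Nat.add_sub_cancel]
        omega
    · rintro ⟨-, h2⟩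
      exact Or.inr ⟨i - lam.colLen 0, j, h2, by omega, rfl⟩

theorem antitone_star_left (lam mu : YoungDiagram) :
    Antitone fun i => if i < lam.colLen 0 then mu.rowLen 0 else 0 := by
  intro a b hab
  dsimp only
  split_ifs <;> omega

theorem antitone_star_right (lam mu : YoungDiagram) :
    Antitone fun i => if i < lam.colLen 0 then mu.rowLen 0 + lam.rowLen i
      else mu.rowLen (i - lam.colLen 0) := by
  intro a b hab
  dsimp only
  have h1 := lam.antitone_rowLen hab
  have h2 := mu.antitone_rowLen (show a - lam.colLen 0 ≤ b - lam.colLen 0 by omega)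
  have h3 := mu.antitone_rowLen (Nat.zero_le (b - lam.colLen 0))
  split_ifs <;> omega

theorem isConvex_starCells (lam mu : YoungDiagram) : IsConvex (starCells lam mu) :=
  isConvex_of_rows mem_starCells (antitone_star_left lam mu) (antitone_star_right lam mu)

theorem card_starCells (lam mu : YoungDiagram) :
    (starCells lam mu).card = lam.card + mu.card := by
  rw [starCells, Finset.card_union_of_disjoint, Finset.card_image_of_injective,
    Finset.card_image_of_injective]
  · rintro ⟨a, b⟩ ⟨c, d⟩ h
    simp only [Prod.mk.injEq] at h ⊢
    omega
  · rintro ⟨a, b⟩ ⟨c, d⟩ h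
    simp only [Prod.mk.injEq] at h ⊢
    omega
  · rw [Finset.disjoint_left]
    simp only [Finset.mem_image, YoungDiagram.mem_cells, Prod.exists, not_exists]
    rintro _ ⟨a, b, h, rfl⟩ c d ⟨-, h'⟩
    simp only [Prod.mk.injEq] at h'
    rw [YoungDiagram.mem_iff_lt_rowLen] at h
    have := YoungDiagram.lt_colLen_zero_iff (mu := lam) (i := a)
    omega

theorem cLR_ne_zero_iff (lam mu nu : YoungDiagram) :
    cLR lam mu nu ≠ 0 ↔ ∃ f, IsTab (starCells lam mu) f ∧
      (∀ i, IsLatticeAt (starCells lam mu) f i) ∧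
      ∀ i, totalCount (starCells lam mu) f i = nu.rowLen i := by
  rw [cLR, neg_one_pow_mul_natCard_ne_zero_iff,
    natCard_isRLW_ne_zero_iff (isConvex_starCells lam mu)]

theorem mem_sdiff_cells {lam nu : YoungDiagram} (i j : ℕ) :
    (i, j) ∈ nu.cells \ lam.cells ↔ lam.rowLen i ≤ j ∧ j < nu.rowLen i := by
  simp only [Finset.mem_sdiff, YoungDiagram.mem_cells, YoungDiagram.mem_iff_lt_rowLen]
  omega

theorem isConvex_sdiff_cells (lam nu : YoungDiagram) : IsConvex (nu.cells \ lam.cells) :=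
  isConvex_of_rows mem_sdiff_cells lam.antitone_rowLen nu.antitone_rowLen

theorem mem_cells_iff {nu : YoungDiagram} (i j : ℕ) :
    (i, j) ∈ nu.cells ↔ 0 ≤ j ∧ j < nu.rowLen i := by
  simp [YoungDiagram.mem_iff_lt_rowLen]

theorem isConvex_cells (nu : YoungDiagram) : IsConvex nu.cells :=
  isConvex_of_rows mem_cells_iff (l := fun _ => 0) antitone_const nu.antitone_rowLen

/-- The letters at which the tableaux counted by `dCoeff` satisfy the lattice condition. -/
def latticeLetters (p q : ℕ) : Set ℕ := {t | t + 1 < p ∨ (p ≤ t ∧ t + 1 < p + q)}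

theorem dCoeff_ne_zero_iff (lam mu nu : YoungDiagram) :
    dCoeff lam mu nu ≠ 0 ↔ ∃ f, IsTab nu.cells f ∧
      (∀ i ∈ latticeLetters (lam.colLen 0) (mu.colLen 0), IsLatticeAt nu.cells f i) ∧
      ∀ i, totalCount nu.cells f i =
        if i < lam.colLen 0 then lam.rowLen i else mu.rowLen (i - lam.colLen 0) := by
  rw [dCoeff, neg_one_pow_mul_natCard_ne_zero_iff,
    SVT.natCard_ne_zero_iff (lam.colLen 0 + mu.colLen 0) fun T hT =>
      T.bounded_of_count fun i hi => by
        rw [hT.2.2, if_neg (by omega), YoungDiagram.rowLen_eq_zero (by omega)]]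
  simp only [SVT.isPartialRLW_word_iff (isConvex_cells nu), SVT.count_word, latticeLetters,
    Set.mem_ofPred_eq]
  constructor
  · rintro ⟨T, h1, h2, h3⟩
    exact ⟨T.entry, T.isTab, fun i hi => hi.elim (h1 i (Nat.zero_le i)) fun hi => h2 i hi.1 hi.2,
      h3⟩
  · rintro ⟨f, hf, h1, h2⟩
    exact ⟨SVT.ofIsTab hf, fun t _ ht => h1 t (Or.inl ht),
      fun t ht ht' => h1 t (Or.inr ⟨ht, ht'⟩), h2⟩

end Coefficients

section Paths

variable {lam mu nu : YoungDiagram}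

/-- Removing one letter from a lattice tableau with more entries than boxes. -/
theorem exists_content_erase {S : Finset (ℕ × ℕ)} (hS : IsConvex S) {f : ℕ × ℕ → Finset ℕ}
    (hf : IsTab S f) (hlat : ∀ i, IsLatticeAt S f i)
    (hc : ∀ i, totalCount S f i = mu.rowLen i) (h : S.card < mu.card) :
    ∃ mt : YoungDiagram, mt ≤ mu ∧ mt.card + 1 = mu.card ∧
      ∃ f', IsTab S f' ∧ (∀ i, IsLatticeAt S f' i) ∧ ∀ i, totalCount S f' i = mt.rowLen i := by
  obtain ⟨c, hcard⟩ := exists_one_lt_card_of_content hc h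
  obtain ⟨x, hx⟩ := Finset.card_pos.1 (zero_lt_one.trans hcard)
  obtain ⟨b, -, f', hf', hlat', htot⟩ :=
    exists_remove hS hf (P := Set.univ) (fun i _ => hlat i) hx hcard
  have h1 := isLatticeAt_totalCount_le (hlat' b trivial)
  have h2 := htot b
  have h3 := htot (b + 1)
  rw [if_pos rfl, hc] at h2
  rw [if_neg (by omega), hc] at h3
  obtain ⟨mt, hle, hmt, -, hrow⟩ := mu.exists_erase_corner (b := b) (by omega)
  refine ⟨mt, hle, hmt, f', hf', fun i => hlat' i trivial, fun i => ?_⟩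
  have h4 := htot i
  have h5 := hrow i
  rw [hc] at h4
  omega

theorem cLR_path_content (h : cLR lam mu nu ≠ 0) (hlt : lam.card + mu.card < nu.card) :
    ∃ nt : YoungDiagram, nt ≤ nu ∧ nt.card + 1 = nu.card ∧ cLR lam mu nt ≠ 0 := by
  obtain ⟨f, hf, hlat, hc⟩ := (cLR_ne_zero_iff _ _ _).1 h
  obtain ⟨nt, h1, h2, h3⟩ := exists_content_erase (isConvex_starCells lam mu) hf hlat hc
    (by rwa [card_starCells])
  exact ⟨nt, h1, h2, (cLR_ne_zero_iff _ _ _).2 h3⟩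

theorem alphaCoeff_path_content (hle : lam ≤ nu)
    (h : alphaCoeff (nu.cells \ lam.cells) mu ≠ 0) (hlt : nu.card - lam.card < mu.card) :
    ∃ mt : YoungDiagram, mt ≤ mu ∧ mt.card + 1 = mu.card ∧
      alphaCoeff (nu.cells \ lam.cells) mt ≠ 0 := by
  have hS := isConvex_sdiff_cells lam nu
  obtain ⟨f, hf, hlat, hc⟩ := (alphaCoeff_ne_zero_iff hS _).1 h
  obtain ⟨mt, h1, h2, h3⟩ := exists_content_erase hS hf hlat hc
    (by rwa [Finset.card_sdiff_of_subset (YoungDiagram.cells_subset_iff.2 hle)])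
  exact ⟨mt, h1, h2, (alphaCoeff_ne_zero_iff hS _).2 h3⟩

/-- If a column starts in row `0` and one of its boxes contains `m < m'`, then the lattice
condition fails for some letter below `m'`. -/
theorem not_isLatticeAt_of_lt {S : Finset (ℕ × ℕ)} {f : ℕ × ℕ → Finset ℕ} (hf : IsTab S f)
    {c : ℕ × ℕ} (hcol : ∀ i ≤ c.1, (i, c.2) ∈ S) {m m' : ℕ} (hm : m ∈ f c) (hm' : m' ∈ f c)
    (hlt : m < m') : ¬ ∀ i < m', IsLatticeAt S f i := by
  intro hlat
  have h1 := le_row_of_isLatticeAt hf hlat hm'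
  have h2 := row_le_of_mem hf hcol m hm
  omega

theorem exists_lt_of_one_lt_card {s : Finset ℕ} (h : 1 < s.card) : ∃ m ∈ s, ∃ n ∈ s, m < n := by
  obtain ⟨a, ha, b, hb, hab⟩ := Finset.one_lt_card.1 h
  rcases hab.lt_or_gt with h | h
  · exact ⟨a, ha, b, hb, h⟩
  · exact ⟨b, hb, a, ha, h⟩

theorem starCells_insert_corner {mt : YoungDiagram} {t : ℕ}
    (hmt : mt.cells = insert (t + 1, mu.rowLen (t + 1)) mu.cells) :
    starCells lam mt =
      insert (t + lam.colLen 0 + 1, mu.rowLen (t + 1)) (starCells lam mu) := by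
  have h0 : mt.rowLen 0 = mu.rowLen 0 := YoungDiagram.rowLen_eq_of_mem_iff fun j => by
    rw [← YoungDiagram.mem_cells, hmt]
    simp [YoungDiagram.mem_iff_lt_rowLen]
  rw [starCells, starCells, h0, hmt, Finset.image_insert, Finset.union_insert]
  congr 2
  dsimp only
  omega

theorem cLR_path_right (h : cLR lam mu nu ≠ 0) (hlt : lam.card + mu.card < nu.card) :
    ∃ mt : YoungDiagram, mu ≤ mt ∧ mt.card = mu.card + 1 ∧ cLR lam mt nu ≠ 0 := by
  obtain ⟨f, hf, hlat, hc⟩ := (cLR_ne_zero_iff _ _ _).1 h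
  obtain ⟨c, hcard, t, hct, het, f', hf', hlat', htot⟩ := exists_add_box_below mem_starCells
    (antitone_star_left lam mu) (antitone_star_right lam mu) hf (P := Set.univ)
    (fun i _ => hlat i) (exists_one_lt_card_of_content hc (by rwa [card_starCells]))
  have hp : lam.colLen 0 ≤ t := by
    by_contra! hp
    obtain ⟨m, hm, m', hm', hmm⟩ := exists_lt_of_one_lt_card hcard
    refine not_isLatticeAt_of_lt hf (fun i hi => ?_) hm hm' hmm fun i _ => hlat i
    have h1 := (mem_starCells c.1 c.2).1 (hf.mem_of_mem hm)
    have h2 := lam.antitone_rowLen hi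
    rw [if_pos (by omega), if_pos (by omega)] at h1
    rw [mem_starCells, if_pos (by omega), if_pos (by omega)]
    omega
  obtain ⟨t, rfl⟩ := Nat.exists_eq_add_of_le' hp
  rw [if_neg (by omega), if_neg (by omega), Nat.add_sub_cancel, Nat.add_right_comm,
    Nat.add_sub_cancel] at het
  obtain ⟨mt, hle, hmt, hcells⟩ := mu.exists_insert_corner het
  refine ⟨mt, hle, hmt, (cLR_ne_zero_iff _ _ _).2 ?_⟩
  rw [if_neg (by omega), show t + lam.colLen 0 + 1 - lam.colLen 0 = t + 1 by omega,
    ← starCells_insert_corner hcells] at hf' hlat' htot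
  exact ⟨f', hf', fun i => hlat' i trivial, fun i => (htot i).trans (hc i)⟩

theorem alphaCoeff_path_outer (hle : lam ≤ nu)
    (h : alphaCoeff (nu.cells \ lam.cells) mu ≠ 0) (hlt : nu.card - lam.card < mu.card) :
    ∃ nt : YoungDiagram, nu ≤ nt ∧ nt.card = nu.card + 1 ∧
      alphaCoeff (nt.cells \ lam.cells) mu ≠ 0 := by
  obtain ⟨f, hf, hlat, hc⟩ := (alphaCoeff_ne_zero_iff (isConvex_sdiff_cells lam nu) _).1 h
  obtain ⟨-, -, t, -, het, f', hf', hlat', htot⟩ := exists_add_box_below mem_sdiff_cells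
    lam.antitone_rowLen nu.antitone_rowLen hf (P := Set.univ) (fun i _ => hlat i)
    (exists_one_lt_card_of_content hc
      (by rwa [Finset.card_sdiff_of_subset (YoungDiagram.cells_subset_iff.2 hle)]))
  obtain ⟨nt, hnt, hcard, hcells⟩ := nu.exists_insert_corner het
  refine ⟨nt, hnt, hcard, (alphaCoeff_ne_zero_iff (isConvex_sdiff_cells lam nt) _).2 ?_⟩
  have hnot : (t + 1, nu.rowLen (t + 1)) ∉ lam.cells := fun hmem => by
    have := hle hmem
    simp [YoungDiagram.mem_iff_lt_rowLen] at this
  rw [hcells, Finset.insert_sdiff_of_notMem _ hnot]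
  exact ⟨f', hf', fun i => hlat' i trivial, fun i => (htot i).trans (hc i)⟩

theorem alphaCoeff_path_inner (hle : lam ≤ nu)
    (h : alphaCoeff (nu.cells \ lam.cells) mu ≠ 0) (hlt : nu.card - lam.card < mu.card) :
    ∃ lt : YoungDiagram, lt ≤ lam ∧ lt.card + 1 = lam.card ∧
      alphaCoeff (nu.cells \ lt.cells) mu ≠ 0 := by
  obtain ⟨f, hf, hlat, hc⟩ := (alphaCoeff_ne_zero_iff (isConvex_sdiff_cells lam nu) _).1 h
  obtain ⟨t, het, f', hf', hlat', htot⟩ := exists_add_box_above mem_sdiff_cells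
    lam.antitone_rowLen nu.antitone_rowLen hf hlat (exists_one_lt_card_of_content hc
      (by rwa [Finset.card_sdiff_of_subset (YoungDiagram.cells_subset_iff.2 hle)]))
  obtain ⟨lt, hlt, hcard, hcells, -⟩ := lam.exists_erase_corner het
  refine ⟨lt, hlt, hcard, (alphaCoeff_ne_zero_iff (isConvex_sdiff_cells lt nu) _).2 ?_⟩
  have hmem : (t, lam.rowLen t - 1) ∈ nu.cells := hle (by
    rw [YoungDiagram.mem_iff_lt_rowLen]
    omega)
  rw [hcells, Finset.sdiff_erase hmem]
  exact ⟨f', hf', hlat', fun i => (htot i).trans (hc i)⟩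

theorem sum_range_content (lam mu : YoungDiagram) :
    (∑ i ∈ Finset.range (lam.colLen 0 + mu.colLen 0),
      if i < lam.colLen 0 then lam.rowLen i else mu.rowLen (i - lam.colLen 0)) =
      lam.card + mu.card := by
  rw [Finset.sum_range_add, ← lam.sum_rowLen le_rfl, ← mu.sum_rowLen le_rfl]
  congr 1
  · exact Finset.sum_congr rfl fun i hi => if_pos (Finset.mem_range.1 hi)
  · exact Finset.sum_congr rfl fun i _ => by simp

theorem exists_one_lt_card_of_two_contents {S : Finset (ℕ × ℕ)} {f : ℕ × ℕ → Finset ℕ}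
    (hc : ∀ i, totalCount S f i =
      if i < lam.colLen 0 then lam.rowLen i else mu.rowLen (i - lam.colLen 0))
    (h : S.card < lam.card + mu.card) : ∃ c, 1 < (f c).card := by
  refine exists_one_lt_card (S := S) (M := lam.colLen 0 + mu.colLen 0) (fun i hi => ?_) ?_
  · rw [hc, if_neg (by omega), YoungDiagram.rowLen_eq_zero (by omega)]
  · simp only [hc]
    rwa [sum_range_content]

theorem dCoeff_path_shape (h : dCoeff lam mu nu ≠ 0) (hlt : nu.card < lam.card + mu.card) :
    ∃ nt : YoungDiagram, nu ≤ nt ∧ nt.card = nu.card + 1 ∧ dCoeff lam mu nt ≠ 0 := by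
  obtain ⟨f, hf, hlat, hc⟩ := (dCoeff_ne_zero_iff _ _ _).1 h
  obtain ⟨-, -, t, -, het, f', hf', hlat', htot⟩ := exists_add_box_below mem_cells_iff
    (l := fun _ => 0) antitone_const nu.antitone_rowLen hf hlat
    (exists_one_lt_card_of_two_contents hc hlt)
  obtain ⟨nt, hnt, hcard, hcells⟩ := nu.exists_insert_corner het
  refine ⟨nt, hnt, hcard, (dCoeff_ne_zero_iff _ _ _).2 ?_⟩
  rw [hcells]
  exact ⟨f', hf', hlat', fun i => (htot i).trans (hc i)⟩

theorem dCoeff_path_right (h : dCoeff lam mu nu ≠ 0) (hlt : nu.card < lam.card + mu.card) :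
    ∃ mt : YoungDiagram, mt ≤ mu ∧ mt.card + 1 = mu.card ∧ dCoeff lam mt nu ≠ 0 := by
  obtain ⟨f, hf, hlat, hc⟩ := (dCoeff_ne_zero_iff _ _ _).1 h
  obtain ⟨c, hcard⟩ := exists_one_lt_card_of_two_contents hc hlt
  obtain ⟨m, hm, m', hm', hmm⟩ := exists_lt_of_one_lt_card hcard
  have hp : lam.colLen 0 ≤ m' := by
    by_contra! hp
    exact not_isLatticeAt_of_lt hf
      (fun i hi => nu.up_left_mem hi le_rfl (hf.mem_of_mem hm)) hm hm' hmm
      fun i hi => hlat i (Or.inl (by omega))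
  obtain ⟨b, hb, f', hf', hlat', htot⟩ := exists_remove (isConvex_cells nu) hf hlat hm' hcard
  obtain ⟨b, rfl⟩ := Nat.exists_eq_add_of_le' (hp.trans hb)
  have hcorner : mu.rowLen (b + 1) < mu.rowLen b := by
    have h1 := htot (b + lam.colLen 0)
    have h2 := htot (b + lam.colLen 0 + 1)
    rw [if_pos rfl, hc, if_neg (by omega), Nat.add_sub_cancel] at h1
    rw [if_neg (by omega), hc, if_neg (by omega),
      show b + lam.colLen 0 + 1 - lam.colLen 0 = b + 1 by omega] at h2
    by_cases hq : b + 1 < mu.colLen 0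
    · have := isLatticeAt_totalCount_le (hlat' (b + lam.colLen 0)
        (Or.inr ⟨by omega, by omega⟩))
      omega
    · rw [YoungDiagram.rowLen_eq_zero (not_lt.1 hq)]
      omega
  obtain ⟨mt, hle, hmt, -, hrow⟩ := mu.exists_erase_corner hcorner
  have hq : mt.colLen 0 ≤ mu.colLen 0 := by
    by_contra! hq
    have h1 := YoungDiagram.lt_colLen_zero_iff.1 hq
    have h2 := hrow (mu.colLen 0)
    rw [YoungDiagram.rowLen_eq_zero le_rfl] at h2
    omega
  refine ⟨mt, hle, hmt, (dCoeff_ne_zero_iff _ _ _).2 ⟨f', hf', fun i hi => hlat' i ?_,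
    fun i => ?_⟩⟩
  · exact hi.imp id fun hi => ⟨hi.1, by omega⟩
  · have h1 := htot i
    have h2 := hrow (i - lam.colLen 0)
    rw [hc] at h1
    split_ifs at h1 h2 ⊢ <;> omega

end Paths

/-- **Paths of nonzero structure constants** (Proposition 7.5): the nonzero
constants `c^ν_{λμ}`, `d^ν_{λμ}` and `α_{ν/λ,μ}` come in paths starting at the
classical Littlewood–Richardson coefficients, in the seven senses (i)–(vii). -/
theorem structure_constant_paths (lam mu nu : YoungDiagram) :
    (cLR lam mu nu ≠ 0 → lam.card + mu.card < nu.card →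
      ∃ nt : YoungDiagram, nt ≤ nu ∧ nt.card + 1 = nu.card ∧ cLR lam mu nt ≠ 0) ∧
    (cLR lam mu nu ≠ 0 → lam.card + mu.card < nu.card →
      ∃ mt : YoungDiagram, mu ≤ mt ∧ mt.card = mu.card + 1 ∧ cLR lam mt nu ≠ 0) ∧
    (dCoeff lam mu nu ≠ 0 → nu.card < lam.card + mu.card →
      ∃ nt : YoungDiagram, nu ≤ nt ∧ nt.card = nu.card + 1 ∧ dCoeff lam mu nt ≠ 0) ∧
    (dCoeff lam mu nu ≠ 0 → nu.card < lam.card + mu.card →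
      ∃ mt : YoungDiagram, mt ≤ mu ∧ mt.card + 1 = mu.card ∧ dCoeff lam mt nu ≠ 0) ∧
    (lam ≤ nu → alphaCoeff (nu.cells \ lam.cells) mu ≠ 0 →
      nu.card - lam.card < mu.card →
      ∃ mt : YoungDiagram, mt ≤ mu ∧ mt.card + 1 = mu.card ∧
        alphaCoeff (nu.cells \ lam.cells) mt ≠ 0) ∧
    (lam ≤ nu → alphaCoeff (nu.cells \ lam.cells) mu ≠ 0 →
      nu.card - lam.card < mu.card →
      ∃ nt : YoungDiagram, nu ≤ nt ∧ nt.card = nu.card + 1 ∧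
        alphaCoeff (nt.cells \ lam.cells) mu ≠ 0) ∧
    (lam ≤ nu → alphaCoeff (nu.cells \ lam.cells) mu ≠ 0 →
      nu.card - lam.card < mu.card →
      ∃ lt : YoungDiagram, lt ≤ lam ∧ lt.card + 1 = lam.card ∧
        alphaCoeff (nu.cells \ lt.cells) mu ≠ 0) := by
  exact ⟨cLR_path_content, cLR_path_right, dCoeff_path_shape, dCoeff_path_right,
    alphaCoeff_path_content, alphaCoeff_path_outer, alphaCoeff_path_inner⟩
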